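/- For every central triangular galaxy H there exists ε = ε(K_6,H) > 0 such that every {K_6,H}-free tournament T contains a transitive subtournament of size at least |T|^ε (i.e., the pair {K_6,H} satisfies the Erdős–Hajnal Conjecture). -/

import Mathlib

open Finset

/-- A tournament on vertex set `Fin n`: `adj u v` means there is an arc from `u` to `v`. -/
structure Tournament (n : ℕ) where
  adj : Fin n → Fin n → Prop
  asymm : ∀ u v, adj u v → ¬ adj v u
  total : ∀ u v, u ≠ v → adj u v ∨ adj v u

namespace Tournament

variable {n N : ℕ}

/-- The position of vertex `v` in the ordering `θ`, where `θ k` is the `k`-th vertex. -/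
def pos (θ : Equiv.Perm (Fin n)) (v : Fin n) : Fin n := θ.symm v

/-- The arc `u → v` of `T` is a backward arc under the ordering `θ`. -/
def Backward (T : Tournament n) (θ : Equiv.Perm (Fin n)) (u v : Fin n) : Prop :=
  T.adj u v ∧ pos θ v < pos θ u

/-- `x` lies strictly between two elements of `L` under the ordering `θ`. -/
def BetweenSet (θ : Equiv.Perm (Fin n)) (L : Finset (Fin n)) (x : Fin n) : Prop :=
  ∃ u ∈ L, ∃ w ∈ L, pos θ u < pos θ x ∧ pos θ x < pos θ w

/-- The induced subtournament of `T` on `s` is transitive. -/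
def IsTransOn (T : Tournament n) (s : Finset (Fin n)) : Prop :=
  ∀ u ∈ s, ∀ v ∈ s, ∀ w ∈ s, T.adj u v → T.adj v w → T.adj u w

/-- The largest size of a transitive subtournament of `T` contained in `s`. -/
noncomputable def trSizeOn (T : Tournament n) (s : Finset (Fin n)) : ℕ :=
  sSup {k | ∃ t, t ⊆ s ∧ T.IsTransOn t ∧ t.card = k}

/-- `tr(T)`: the largest size of a transitive subtournament of `T`. -/
noncomputable def trSize (T : Tournament n) : ℕ := T.trSizeOn Finset.univ

/-- `T` contains `H`: some induced subtournament of `T` is isomorphic to `H`. -/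
def Contains (T : Tournament N) (H : Tournament n) : Prop :=
  ∃ f : Fin n ↪ Fin N, ∀ u v, H.adj u v ↔ T.adj (f u) (f v)

/-- `T` is `ε`-critical. -/
def EpsCritical (T : Tournament n) (ε : ℝ) : Prop :=
  ((T.trSize : ℝ) < (n : ℝ) ^ ε) ∧
  ∀ s : Finset (Fin n), s ≠ Finset.univ → ((s.card : ℝ) ^ ε ≤ (T.trSizeOn s : ℝ))

/-- `S` with center `c` is a right star of `T` under `θ`. -/
def IsRightStarAt (T : Tournament n) (θ : Equiv.Perm (Fin n)) (S : Finset (Fin n))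
    (c : Fin n) : Prop :=
  c ∈ S ∧ (S.erase c).Nonempty ∧
  (∀ v ∈ S.erase c, pos θ v < pos θ c ∧ T.adj c v) ∧
  (∀ u ∈ S, ∀ v ∈ S, T.Backward θ u v → u = c)

/-- `S` with center `c` is a left star of `T` under `θ`. -/
def IsLeftStarAt (T : Tournament n) (θ : Equiv.Perm (Fin n)) (S : Finset (Fin n))
    (c : Fin n) : Prop :=
  c ∈ S ∧ (S.erase c).Nonempty ∧
  (∀ v ∈ S.erase c, pos θ c < pos θ v ∧ T.adj v c) ∧
  (∀ u ∈ S, ∀ v ∈ S, T.Backward θ u v → v = c)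

/-- `S` with center `c` is a middle star of `T` under `θ`. -/
def IsMiddleStarAt (T : Tournament n) (θ : Equiv.Perm (Fin n)) (S : Finset (Fin n))
    (c : Fin n) : Prop :=
  c ∈ S ∧
  (∃ v ∈ S.erase c, pos θ v < pos θ c) ∧ (∃ v ∈ S.erase c, pos θ c < pos θ v) ∧
  (∀ v ∈ S.erase c, (pos θ v < pos θ c → T.adj c v) ∧ (pos θ c < pos θ v → T.adj v c)) ∧
  (∀ u ∈ S, ∀ v ∈ S, T.Backward θ u v → u = c ∨ v = c)

def IsFrontierStarAt (T : Tournament n) (θ : Equiv.Perm (Fin n)) (S : Finset (Fin n))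
    (c : Fin n) : Prop :=
  T.IsLeftStarAt θ S c ∨ T.IsRightStarAt θ S c

def IsStarAt (T : Tournament n) (θ : Equiv.Perm (Fin n)) (S : Finset (Fin n))
    (c : Fin n) : Prop :=
  T.IsLeftStarAt θ S c ∨ T.IsRightStarAt θ S c ∨ T.IsMiddleStarAt θ S c

/-- A middle star with exactly one leaf after the center (center is `u_{p-1}`). -/
def IsOneRightMiddleStarAt (T : Tournament n) (θ : Equiv.Perm (Fin n)) (S : Finset (Fin n))
    (c : Fin n) : Prop :=
  T.IsMiddleStarAt θ S c ∧ ((S.erase c).filter (fun v => pos θ c < pos θ v)).card = 1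

/-- A middle star with exactly one leaf before the center (center is `u_2`). -/
def IsOneLeftMiddleStarAt (T : Tournament n) (θ : Equiv.Perm (Fin n)) (S : Finset (Fin n))
    (c : Fin n) : Prop :=
  T.IsMiddleStarAt θ S c ∧ ((S.erase c).filter (fun v => pos θ v < pos θ c)).card = 1

/-- Kinds of super 2-nebulas. -/
inductive NebKind
  | left
  | middle
  | right

/-- Common requirements on the data of a super 2-nebula: vertex set `S`, centers `c₁, c₂`
(`c₁` before `c₂` under `θ`), leaves `L₁` incident to `c₁` and `L₂` incident to `c₂`. -/
def Super2NebCommon (θ : Equiv.Perm (Fin n)) (S : Finset (Fin n)) (c₁ c₂ : Fin n)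
    (L₁ L₂ : Finset (Fin n)) : Prop :=
  L₁.Nonempty ∧ L₂.Nonempty ∧ Disjoint L₁ L₂ ∧
  c₁ ∉ L₁ ∪ L₂ ∧ c₂ ∉ L₁ ∪ L₂ ∧ c₁ ≠ c₂ ∧
  S = insert c₁ (insert c₂ (L₁ ∪ L₂)) ∧ pos θ c₁ < pos θ c₂

/-- `S` is a super (left/middle/right) 2-nebula of `T` under `θ`, with centers `c₁, c₂` and
leaves `L₁` (incident to `c₁`) and `L₂` (incident to `c₂`). -/
def IsSuper2NebulaAt (T : Tournament n) (θ : Equiv.Perm (Fin n)) (S : Finset (Fin n))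
    (c₁ c₂ : Fin n) (L₁ L₂ : Finset (Fin n)) : NebKind → Prop
  | NebKind.middle =>
      Super2NebCommon θ S c₁ c₂ L₁ L₂ ∧
      (∀ v ∈ L₁ ∪ L₂, pos θ c₁ < pos θ v ∧ pos θ v < pos θ c₂) ∧
      (∀ v ∈ L₁, T.adj v c₁) ∧ (∀ v ∈ L₂, T.adj c₂ v) ∧ T.adj c₂ c₁ ∧
      (∀ u ∈ S, ∀ v ∈ S, T.Backward θ u v →
        (u ∈ L₁ ∧ v = c₁) ∨ (u = c₂ ∧ v ∈ L₂) ∨ (u = c₂ ∧ v = c₁))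
  | NebKind.left =>
      Super2NebCommon θ S c₁ c₂ L₁ L₂ ∧
      (∀ v ∈ L₁ ∪ L₂, pos θ v < pos θ c₁) ∧
      (∀ v ∈ L₁, T.adj c₁ v) ∧ (∀ v ∈ L₂, T.adj c₂ v) ∧ T.adj c₂ c₁ ∧
      (∀ u ∈ S, ∀ v ∈ S, T.Backward θ u v →
        (u = c₁ ∧ v ∈ L₁) ∨ (u = c₂ ∧ v ∈ L₂) ∨ (u = c₂ ∧ v = c₁))
  | NebKind.right =>
      Super2NebCommon θ S c₁ c₂ L₁ L₂ ∧
      (∀ v ∈ L₁ ∪ L₂, pos θ c₂ < pos θ v) ∧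
      (∀ v ∈ L₁, T.adj v c₁) ∧ (∀ v ∈ L₂, T.adj v c₂) ∧ T.adj c₂ c₁ ∧
      (∀ u ∈ S, ∀ v ∈ S, T.Backward θ u v →
        (u ∈ L₁ ∧ v = c₁) ∨ (u ∈ L₂ ∧ v = c₂) ∨ (u = c₂ ∧ v = c₁))

/-- A decomposition of `T` witnessing that `T` is a super nebula under `θ`, with stars
`Q i` (centers `ctr i`) and super 2-nebulas `Sig i` (centers `c₁ i, c₂ i`, leaves
`L₁ i, L₂ i`, of kind `kd i`). -/
def SuperNebulaDecomp (T : Tournament n) (θ : Equiv.Perm (Fin n)) {m l : ℕ}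
    (Q : Fin m → Finset (Fin n)) (ctr : Fin m → Fin n)
    (Sig : Fin l → Finset (Fin n)) (c₁ c₂ : Fin l → Fin n)
    (L₁ L₂ : Fin l → Finset (Fin n)) (kd : Fin l → NebKind) : Prop :=
  (∀ i, T.IsStarAt θ (Q i) (ctr i)) ∧
  (∀ i, T.IsSuper2NebulaAt θ (Sig i) (c₁ i) (c₂ i) (L₁ i) (L₂ i) (kd i)) ∧
  (∀ i j, i ≠ j → Disjoint (Q i) (Q j)) ∧
  (∀ i j, i ≠ j → Disjoint (Sig i) (Sig j)) ∧
  (∀ i j, Disjoint (Q i) (Sig j)) ∧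
  (∀ u v, T.Backward θ u v → (∃ i, u ∈ Q i ∧ v ∈ Q i) ∨ (∃ i, u ∈ Sig i ∧ v ∈ Sig i)) ∧
  (∀ i j, ¬ BetweenSet θ (L₁ j ∪ L₂ j) (ctr i)) ∧
  (∀ i j, i ≠ j → ¬ BetweenSet θ (L₁ j ∪ L₂ j) (c₁ i) ∧ ¬ BetweenSet θ (L₁ j ∪ L₂ j) (c₂ i))

/-- `T` is a super nebula. -/
def IsSuperNebula (T : Tournament n) : Prop :=
  ∃ (θ : Equiv.Perm (Fin n)) (m l : ℕ) (Q : Fin m → Finset (Fin n)) (ctr : Fin m → Fin n)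
    (Sig : Fin l → Finset (Fin n)) (c₁ c₂ : Fin l → Fin n)
    (L₁ L₂ : Fin l → Finset (Fin n)) (kd : Fin l → NebKind),
    SuperNebulaDecomp T θ Q ctr Sig c₁ c₂ L₁ L₂ kd

/-- `{a, b, c}` (in this position order) is a triangle of `T` under `θ`:
`a` is the left exterior, `b` the center, `c` the right exterior. -/
def IsTriangleAt (T : Tournament n) (θ : Equiv.Perm (Fin n)) (a b c : Fin n) : Prop :=
  pos θ a < pos θ b ∧ pos θ b < pos θ c ∧ T.adj b a ∧ T.adj c a ∧ T.adj c b

/-- A decomposition of `T` under `θ` into triangles `{A i, B i, C i}` (left exterior, center,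
right exterior) and frontier stars `Q j` with centers `ctr j`, where for each triangle `i`,
the vertices in `forb i` are not allowed to lie between leaves of a star. -/
def TriGalaxyDecomp (T : Tournament n) (θ : Equiv.Perm (Fin n)) {l k : ℕ}
    (A B C : Fin l → Fin n) (Q : Fin k → Finset (Fin n)) (ctr : Fin k → Fin n)
    (forb : Fin l → Finset (Fin n)) : Prop :=
  (∀ i, T.IsTriangleAt θ (A i) (B i) (C i)) ∧
  (∀ j, T.IsFrontierStarAt θ (Q j) (ctr j)) ∧
  (∀ i j, i ≠ j →
    Disjoint ({A i, B i, C i} : Finset (Fin n)) ({A j, B j, C j} : Finset (Fin n))) ∧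
  (∀ i j, Disjoint ({A i, B i, C i} : Finset (Fin n)) (Q j)) ∧
  (∀ i j, i ≠ j → Disjoint (Q i) (Q j)) ∧
  (∀ u v, T.Backward θ u v →
    (∃ i, u ∈ ({A i, B i, C i} : Finset (Fin n)) ∧ v ∈ ({A i, B i, C i} : Finset (Fin n))) ∨
    (∃ j, u ∈ Q j ∧ v ∈ Q j)) ∧
  (∀ i j, i ≠ j → ¬ BetweenSet θ ((Q j).erase (ctr j)) (ctr i)) ∧
  (∀ i j, ∀ x ∈ forb i, ¬ BetweenSet θ ((Q j).erase (ctr j)) x)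

/-- `T` is a Δgalaxy: a triangular galaxy with exactly one triangle. -/
def IsDeltaGalaxy (T : Tournament n) : Prop :=
  ∃ (θ : Equiv.Perm (Fin n)) (a b c : Fin n) (k : ℕ)
    (Q : Fin k → Finset (Fin n)) (ctr : Fin k → Fin n),
    TriGalaxyDecomp T θ (fun _ : Fin 1 => a) (fun _ => b) (fun _ => c) Q ctr
      (fun _ => ({a, b, c} : Finset (Fin n)))

/-- `T` is a central triangular galaxy: centers of triangles may lie between leaves of stars. -/
def IsCentralTriangularGalaxy (T : Tournament n) : Prop :=
  ∃ (θ : Equiv.Perm (Fin n)) (l k : ℕ) (A B C : Fin l → Fin n)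
    (Q : Fin k → Finset (Fin n)) (ctr : Fin k → Fin n),
    TriGalaxyDecomp T θ A B C Q ctr (fun i => ({A i, C i} : Finset (Fin n)))

/-- `T` is a left triangular galaxy: left exteriors of triangles may lie between leaves. -/
def IsLeftTriangularGalaxy (T : Tournament n) : Prop :=
  ∃ (θ : Equiv.Perm (Fin n)) (l k : ℕ) (A B C : Fin l → Fin n)
    (Q : Fin k → Finset (Fin n)) (ctr : Fin k → Fin n),
    TriGalaxyDecomp T θ A B C Q ctr (fun i => ({B i, C i} : Finset (Fin n)))

/-- `T` is a right triangular galaxy: right exteriors of triangles may lie between leaves. -/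
def IsRightTriangularGalaxy (T : Tournament n) : Prop :=
  ∃ (θ : Equiv.Perm (Fin n)) (l k : ℕ) (A B C : Fin l → Fin n)
    (Q : Fin k → Finset (Fin n)) (ctr : Fin k → Fin n),
    TriGalaxyDecomp T θ A B C Q ctr (fun i => ({A i, B i} : Finset (Fin n)))

/-- A decomposition of `T` witnessing that `T` is a nebula under `θ` (no condition on the
location of the centers of the stars). -/
def NebulaDecomp (T : Tournament n) (θ : Equiv.Perm (Fin n)) {k : ℕ}
    (Q : Fin k → Finset (Fin n)) (ctr : Fin k → Fin n) : Prop :=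
  (∀ i, T.IsStarAt θ (Q i) (ctr i)) ∧
  (∀ i j, i ≠ j → Disjoint (Q i) (Q j)) ∧
  (∀ u v, T.Backward θ u v → ∃ i, u ∈ Q i ∧ v ∈ Q i)

/-- `T` is a central nebula: a nebula all of whose stars are 3-vertex middle stars. -/
def IsCentralNebula (T : Tournament n) : Prop :=
  ∃ (θ : Equiv.Perm (Fin n)) (k : ℕ) (Q : Fin k → Finset (Fin n)) (ctr : Fin k → Fin n),
    NebulaDecomp T θ Q ctr ∧ ∀ i, T.IsMiddleStarAt θ (Q i) (ctr i) ∧ (Q i).card = 3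

/-- `T` is a super left nebula: a nebula all of whose stars are left stars. -/
def IsSuperLeftNebula (T : Tournament n) : Prop :=
  ∃ (θ : Equiv.Perm (Fin n)) (k : ℕ) (Q : Fin k → Finset (Fin n)) (ctr : Fin k → Fin n),
    NebulaDecomp T θ Q ctr ∧ ∀ i, T.IsLeftStarAt θ (Q i) (ctr i)

/-- `T` is a super right nebula: a nebula all of whose stars are right stars. -/
def IsSuperRightNebula (T : Tournament n) : Prop :=
  ∃ (θ : Equiv.Perm (Fin n)) (k : ℕ) (Q : Fin k → Finset (Fin n)) (ctr : Fin k → Fin n),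
    NebulaDecomp T θ Q ctr ∧ ∀ i, T.IsRightStarAt θ (Q i) (ctr i)

/-- `T` is an LR-Δgalaxy: a super Δgalaxy in which only the two exteriors of the triangle
may lie between leaves of a star. -/
def IsLRDeltaGalaxy (T : Tournament n) : Prop :=
  ∃ (θ : Equiv.Perm (Fin n)) (a b c : Fin n) (k : ℕ)
    (Q : Fin k → Finset (Fin n)) (ctr : Fin k → Fin n),
    TriGalaxyDecomp T θ (fun _ : Fin 1 => a) (fun _ => b) (fun _ => c) Q ctr
      (fun _ => ({b} : Finset (Fin n)))

/-- `T` is a CR-Δgalaxy. -/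
def IsCRDeltaGalaxy (T : Tournament n) : Prop :=
  ∃ (θ : Equiv.Perm (Fin n)) (a b c : Fin n) (k : ℕ)
    (Q : Fin k → Finset (Fin n)) (ctr : Fin k → Fin n),
    TriGalaxyDecomp T θ (fun _ : Fin 1 => a) (fun _ => b) (fun _ => c) Q ctr
      (fun _ => ({a} : Finset (Fin n))) ∧
    (∀ i j, i ≠ j → BetweenSet θ ((Q i).erase (ctr i)) b →
      BetweenSet θ ((Q j).erase (ctr j)) c →
      (∀ x ∈ (Q i).erase (ctr i), ¬ BetweenSet θ ((Q j).erase (ctr j)) x) ∧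
      (∀ x ∈ (Q j).erase (ctr j), ¬ BetweenSet θ ((Q i).erase (ctr i)) x)) ∧
    (∀ i, BetweenSet θ ((Q i).erase (ctr i)) b → ¬ BetweenSet θ ((Q i).erase (ctr i)) c)

/-- `T` is a CL-Δgalaxy. -/
def IsCLDeltaGalaxy (T : Tournament n) : Prop :=
  ∃ (θ : Equiv.Perm (Fin n)) (a b c : Fin n) (k : ℕ)
    (Q : Fin k → Finset (Fin n)) (ctr : Fin k → Fin n),
    TriGalaxyDecomp T θ (fun _ : Fin 1 => a) (fun _ => b) (fun _ => c) Q ctr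
      (fun _ => ({c} : Finset (Fin n))) ∧
    (∀ i j, i ≠ j → BetweenSet θ ((Q i).erase (ctr i)) b →
      BetweenSet θ ((Q j).erase (ctr j)) a →
      (∀ x ∈ (Q i).erase (ctr i), ¬ BetweenSet θ ((Q j).erase (ctr j)) x) ∧
      (∀ x ∈ (Q j).erase (ctr j), ¬ BetweenSet θ ((Q i).erase (ctr i)) x)) ∧
    (∀ i, BetweenSet θ ((Q i).erase (ctr i)) b → ¬ BetweenSet θ ((Q i).erase (ctr i)) a)

/-- A decomposition of `T` under `θ` into one super 2-nebula (of kind `kd`) and frontier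
stars, covering all of `V(T)`, witnessing that `T` is a Σ-galaxy under `θ`. -/
def SigmaGalaxyDecomp (T : Tournament n) (θ : Equiv.Perm (Fin n))
    (S : Finset (Fin n)) (c₁ c₂ : Fin n) (L₁ L₂ : Finset (Fin n)) (kd : NebKind)
    {m : ℕ} (Q : Fin m → Finset (Fin n)) (ctr : Fin m → Fin n) : Prop :=
  T.IsSuper2NebulaAt θ S c₁ c₂ L₁ L₂ kd ∧
  (∀ j, T.IsFrontierStarAt θ (Q j) (ctr j)) ∧
  (∀ i j, i ≠ j → Disjoint (Q i) (Q j)) ∧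
  (∀ j, Disjoint S (Q j)) ∧
  (∀ v, v ∈ S ∨ ∃ j, v ∈ Q j) ∧
  (∀ u v, T.Backward θ u v → (u ∈ S ∧ v ∈ S) ∨ ∃ j, u ∈ Q j ∧ v ∈ Q j) ∧
  (∀ j, ¬ BetweenSet θ (L₁ ∪ L₂) (ctr j)) ∧
  (∀ j, ¬ BetweenSet θ ((Q j).erase (ctr j)) c₁ ∧ ¬ BetweenSet θ ((Q j).erase (ctr j)) c₂) ∧
  (∀ i j, i ≠ j → ¬ BetweenSet θ ((Q j).erase (ctr j)) (ctr i))

def IsMiddleSigmaGalaxy (T : Tournament n) : Prop :=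
  ∃ (θ : Equiv.Perm (Fin n)) (S : Finset (Fin n)) (c₁ c₂ : Fin n) (L₁ L₂ : Finset (Fin n))
    (m : ℕ) (Q : Fin m → Finset (Fin n)) (ctr : Fin m → Fin n),
    SigmaGalaxyDecomp T θ S c₁ c₂ L₁ L₂ NebKind.middle Q ctr

def IsLeftSigmaGalaxy (T : Tournament n) : Prop :=
  ∃ (θ : Equiv.Perm (Fin n)) (S : Finset (Fin n)) (c₁ c₂ : Fin n) (L₁ L₂ : Finset (Fin n))
    (m : ℕ) (Q : Fin m → Finset (Fin n)) (ctr : Fin m → Fin n),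
    SigmaGalaxyDecomp T θ S c₁ c₂ L₁ L₂ NebKind.left Q ctr

def IsRightSigmaGalaxy (T : Tournament n) : Prop :=
  ∃ (θ : Equiv.Perm (Fin n)) (S : Finset (Fin n)) (c₁ c₂ : Fin n) (L₁ L₂ : Finset (Fin n))
    (m : ℕ) (Q : Fin m → Finset (Fin n)) (ctr : Fin m → Fin n),
    SigmaGalaxyDecomp T θ S c₁ c₂ L₁ L₂ NebKind.right Q ctr

/-- The directed density from `X` to `Y`. -/
noncomputable def density (T : Tournament n) (X Y : Finset (Fin n)) : ℝ :=
  (Set.ncard {p : Fin n × Fin n | p.1 ∈ X ∧ p.2 ∈ Y ∧ T.adj p.1 p.2} : ℝ) /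
    ((X.card : ℝ) * (Y.card : ℝ))

/-- `(S i)` is a smooth `(c, lam, w)`-structure of `T`. -/
def IsSmoothStructure (T : Tournament n) (c lam : ℝ) {N : ℕ} (w : Fin N → Bool)
    (S : Fin N → Finset (Fin n)) : Prop :=
  (∀ i j, i ≠ j → Disjoint (S i) (S j)) ∧
  (∀ i, w i = false → c * (n : ℝ) ≤ ((S i).card : ℝ)) ∧
  (∀ i, w i = true → T.IsTransOn (S i) ∧ c * (T.trSize : ℝ) ≤ ((S i).card : ℝ)) ∧
  (∀ i j, i < j →
    (∀ v ∈ S i, 1 - lam ≤ T.density {v} (S j)) ∧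
    (∀ v ∈ S j, 1 - lam ≤ T.density (S i) {v}))

end Tournament

/-- The backward arcs of `K₆` under its canonical ordering. -/
def K6back : List (ℕ × ℕ) := [(3, 0), (5, 2), (5, 0), (4, 1)]

/-- The tournament `K₆`, on `Fin 6` with its canonical ordering. -/
def K6 : Tournament 6 where
  adj u v := (u.val, v.val) ∈ K6back ∨ (u < v ∧ (v.val, u.val) ∉ K6back)
  asymm := by decide
  total := by decide

/-- The pair `{H₁, H₂}` satisfies the Erdős–Hajnal conjecture: there is `ε > 0` such that
every `{H₁, H₂}`-free tournament `T` has a transitive subtournament of size `≥ |T| ^ ε`. -/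
def EHPair {n₁ n₂ : ℕ} (H₁ : Tournament n₁) (H₂ : Tournament n₂) : Prop :=
  ∃ ε : ℝ, 0 < ε ∧ ∀ (n : ℕ) (T : Tournament n),
    ¬ T.Contains H₁ → ¬ T.Contains H₂ → (n : ℝ) ^ ε ≤ (T.trSize : ℝ)

namespace Tournament

open scoped Classical

lemma card_filter_mul_le {α β : Type*} (r : α → β → Prop)
    [∀ a b, Decidable (r a b)] (A : Finset α) (B : Finset β)
    {μ t : ℝ} (hμ : 0 ≤ μ) (h : ∑ a ∈ A, (#{b ∈ B | r a b} : ℝ) ≤ μ * #A * #B) :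
    #{a ∈ A | t * #B < #{b ∈ B | r a b}} * t ≤ μ * #A := by
  rcases B.eq_empty_or_nonempty with rfl | hB
  · simpa using by positivity
  have hB' : (0 : ℝ) < #B := by exact_mod_cast hB.card_pos
  refine le_of_mul_le_mul_right ?_ hB'
  calc _ = ∑ a ∈ A with t * #B < #{b ∈ B | r a b}, t * (#B : ℝ) := by
        rw [sum_const, nsmul_eq_mul]; ring
    _ ≤ ∑ a ∈ A with t * #B < #{b ∈ B | r a b}, (#{b ∈ B | r a b} : ℝ) :=
        sum_le_sum fun a ha => (mem_filter.1 ha).2.le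
    _ ≤ ∑ a ∈ A, (#{b ∈ B | r a b} : ℝ) :=
        sum_le_sum_of_subset_of_nonneg (filter_subset _ _) fun _ _ _ => by positivity
    _ ≤ _ := h

lemma card_le_two_mul_card_filter {α β : Type*} (r : α → β → Prop)
    [∀ a b, Decidable (r a b)] (A : Finset α) (B : Finset β)
    {μ : ℝ} (hμ : 0 < μ) (h : ∑ a ∈ A, (#{b ∈ B | r a b} : ℝ) ≤ μ * #A * #B) :
    (#A : ℝ) ≤ 2 * #{a ∈ A | (#{b ∈ B | r a b} : ℝ) ≤ 2 * μ * #B} := by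
  have h1 := card_filter_mul_le r A B (t := 2 * μ) hμ.le h
  have h2 := card_filter_add_card_filter_not (s := A) (fun a => (#{b ∈ B | r a b} : ℝ) ≤ 2 * μ * #B)
  simp only [not_le] at h2
  have h3 : (#{a ∈ A | (#{b ∈ B | r a b} : ℝ) ≤ 2 * μ * #B} : ℝ)
    + #{a ∈ A | 2 * μ * #B < (#{b ∈ B | r a b} : ℝ)} = #A := by exact_mod_cast h2
  nlinarith

lemma sum_card_filter_comm {α β : Type*} (r : α → β → Prop)
    [∀ a b, Decidable (r a b)] (A : Finset α) (B : Finset β) :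
    ∑ a ∈ A, (#{b ∈ B | r a b} : ℝ) = ∑ b ∈ B, (#{a ∈ A | r a b} : ℝ) := by
  exact_mod_cast sum_card_bipartiteAbove_eq_sum_card_bipartiteBelow r

lemma exists_card_le_mul_card_filter {α ι : Type*} (I : Finset ι) (A : Finset α)
    (P : ι → α → Prop) [∀ i a, Decidable (P i a)] (hA : A.Nonempty) (h : ∀ a ∈ A, ∃ i ∈ I, P i a) :
    ∃ i ∈ I, #A ≤ #I * #{a ∈ A | P i a} := by
  by_contra! hlt
  have hI : I.Nonempty := by
    obtain ⟨a, ha⟩ := hA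
    obtain ⟨i, hi, -⟩ := h a ha
    exact ⟨i, hi⟩
  have h1 : A ⊆ I.biUnion fun i => {a ∈ A | P i a} := fun a ha => by
    obtain ⟨i, hi, hp⟩ := h a ha
    exact mem_biUnion.2 ⟨i, hi, mem_filter.2 ⟨ha, hp⟩⟩
  have h2 : #A ≤ ∑ i ∈ I, #{a ∈ A | P i a} := (card_le_card h1).trans card_biUnion_le
  have h3 : ∑ i ∈ I, #I * #{a ∈ A | P i a} < ∑ i ∈ I, #A := sum_lt_sum_of_nonempty hI hlt
  rw [← mul_sum, sum_const, smul_eq_mul] at h3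
  exact absurd (Nat.lt_of_mul_lt_mul_left h3) h2.not_gt

lemma exists_pairwise_disjoint_subsets {α : Type*} (s : ℕ) (k : ℕ) (X : Finset α)
    (h : k * s ≤ #X) :
    ∃ Z : Fin k → Finset α, (∀ i, Z i ⊆ X ∧ #(Z i) = s) ∧ ∀ i j, i ≠ j → Disjoint (Z i) (Z j) := by
  induction k generalizing X with
  | zero => exact ⟨fun _ => ∅, fun i => i.elim0, fun i => i.elim0⟩
  | succ k ih =>
    rw [Nat.succ_mul] at h
    obtain ⟨Y, hY, hYs⟩ := exists_subset_card_eq (show s ≤ #X by omega)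
    obtain ⟨Z, hZ, hd⟩ := ih (X \ Y) (by rw [card_sdiff_of_subset hY]; omega)
    have hYZ : ∀ i, Disjoint Y (Z i) := fun i => disjoint_sdiff.mono_right (hZ i).1
    refine ⟨Fin.cons Y Z, fun i => ?_, fun i j => ?_⟩
    · cases i using Fin.cases with
      | zero => exact ⟨hY, hYs⟩
      | succ i => exact ⟨(hZ i).1.trans sdiff_subset, (hZ i).2⟩
    · cases i using Fin.cases <;> cases j using Fin.cases <;> intro hij
      · exact absurd rfl hij
      · exact hYZ _
      · exact (hYZ _).symm
      · exact hd _ _ fun e => hij (by simpa [Fin.ext_iff] using e)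

variable {m n : ℕ}

lemma irrefl (T : Tournament n) (v : Fin n) : ¬ T.adj v v := fun h => T.asymm v v h h

lemma adj_of_not_adj (T : Tournament n) {u v : Fin n} (huv : u ≠ v) (h : ¬ T.adj u v) :
    T.adj v u := (T.total u v huv).resolve_left h

lemma contains_of_forall_adj {T : Tournament n} {H : Tournament m} (f : Fin m → Fin n)
    (hf : ∀ u v, H.adj u v → T.adj (f u) (f v)) : T.Contains H := by
  have hinj : Function.Injective f := fun u v huv => by
    by_contra hne
    rcases H.total u v hne with h | h
    · exact T.irrefl _ (huv ▸ hf _ _ h)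
    · exact T.irrefl _ (huv ▸ hf _ _ h)
  refine ⟨⟨f, hinj⟩, fun u v => ⟨hf u v, fun h => ?_⟩⟩
  by_contra hn
  have hne : u ≠ v := by rintro rfl; exact T.irrefl _ h
  exact T.asymm _ _ h (hf _ _ (H.adj_of_not_adj hne hn))

lemma exists_dense_pair (H : Tournament m) {lam : ℝ} (hlam : 0 < lam) :
    ∃ c : ℝ, 0 < c ∧ c ≤ 1 ∧ ∃ N : ℕ, ∀ {n : ℕ} (T : Tournament n), ¬ T.Contains H →
      ∀ X : Finset (Fin n), N ≤ #X → ∃ A ⊆ X, ∃ B ⊆ X, Disjoint A B ∧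
        c * #X ≤ #A ∧ c * #X ≤ #B ∧
        ∑ a ∈ A, (#{b ∈ B | ¬ T.adj a b} : ℝ) ≤ lam * #A * #B := by
  rcases Nat.eq_zero_or_pos m with rfl | hm
  · exact ⟨1, one_pos, le_rfl, 0, fun T hT => absurd (contains_of_forall_adj (fun i => i.elim0)
      fun u => u.elim0) hT⟩
  have hm' : (1 : ℝ) ≤ m := by exact_mod_cast hm
  set l : ℝ := min lam 1 with hl
  have hl0 : 0 < l := lt_min hlam one_pos
  have hl1 : l ≤ 1 := min_le_right _ _
  have hpow : l ^ m ≤ 1 := pow_le_one₀ hl0.le hl1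
  refine ⟨l ^ m / (2 * m * m), by positivity, ?_, m, fun {n} T hT X hX => ?_⟩
  · rw [div_le_one (by positivity)]; nlinarith
  by_contra! hno
  apply hT
  set s : ℕ := #X / m with hs
  have hs1 : 1 ≤ s := (Nat.one_le_div_iff hm).2 hX
  have hsX : (#X : ℝ) ≤ 2 * m * s := by
    have : #X < m * (s + 1) := Nat.lt_mul_div_succ _ hm
    have : #X ≤ 2 * m * s := by nlinarith
    exact_mod_cast this
  obtain ⟨Z₀, hZ₀, hd₀⟩ := exists_pairwise_disjoint_subsets s m X (Nat.mul_div_le _ _)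
  have key : ∀ D : Finset (Fin m), ∃ (f : Fin m → Fin n) (Z : Fin m → Finset (Fin n)),
      (∀ q, Z q ⊆ X) ∧ (∀ p q, p ≠ q → Disjoint (Z p) (Z q)) ∧
      (∀ q ∉ D, l ^ #D * s ≤ #(Z q)) ∧
      (∀ p ∈ D, ∀ q ∈ D, H.adj p q → T.adj (f p) (f q)) ∧
      ∀ p ∈ D, ∀ q ∉ D, ∀ u ∈ Z q,
        (H.adj p q → T.adj (f p) u) ∧ (H.adj q p → T.adj u (f p)) := by
    intro D
    induction D using Finset.induction_on with
    | empty =>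
      obtain ⟨x, -⟩ : X.Nonempty := card_pos.1 (by omega)
      exact ⟨fun _ => x, Z₀, fun q => (hZ₀ q).1, hd₀, fun q _ => by simp [(hZ₀ q).2], by simp,
        by simp⟩
    | insert p D hp ih =>
      obtain ⟨f, Z, hZX, hdis, hcard, hff, hfZ⟩ := ih
      have hZpos : ∀ q ∉ D, (Z q).Nonempty := fun q hq => by
        have h1 := hcard q hq
        have : (0 : ℝ) < l ^ #D * s := by positivity
        exact card_pos.1 (by exact_mod_cast this.trans_le h1)
      obtain ⟨v, hv, hgood⟩ : ∃ v ∈ Z p, ∀ q ∉ insert p D, l * #(Z q) ≤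
          #{u ∈ Z q | (H.adj p q → T.adj v u) ∧ (H.adj q p → T.adj u v)} := by
        by_contra! hbad
        obtain ⟨q, -, hq⟩ := exists_card_le_mul_card_filter univ (Z p)
          (fun q v => q ∉ insert p D ∧ (#{u ∈ Z q | (H.adj p q → T.adj v u) ∧
            (H.adj q p → T.adj u v)} : ℝ) < l * #(Z q)) (hZpos p hp)
          (fun v hv => by
            obtain ⟨q, hq, hlt⟩ := hbad v hv
            exact ⟨q, mem_univ _, hq, hlt⟩)
        set A := {v ∈ Z p | q ∉ insert p D ∧ (#{u ∈ Z q | (H.adj p q → T.adj v u) ∧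
            (H.adj q p → T.adj u v)} : ℝ) < l * #(Z q)} with hA
        simp only [card_univ, Fintype.card_fin] at hq
        have hAne : A.Nonempty := by
          rw [← card_pos]
          have := (hZpos p hp).card_pos
          exact Nat.pos_of_ne_zero fun h0 => by rw [h0] at hq; omega
        obtain ⟨v₀, hv₀⟩ := hAne
        have hqD : q ∉ insert p D := (mem_filter.1 hv₀).2.1
        have hqp : q ≠ p := fun e => hqD (by simp [e])
        have hqD' : q ∉ D := fun e => hqD (by simp [e])
        have hpowD : l ^ m ≤ l ^ #D := pow_le_pow_of_le_one hl0.le hl1 (by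
          simpa using card_le_univ D)
        have hZbig : ∀ q ∉ D, l ^ m / (2 * m) * #X ≤ #(Z q) := fun q hq => by
          refine le_trans ?_ (hcard q hq)
          rw [div_mul_eq_mul_div, div_le_iff₀ (by positivity)]
          calc l ^ m * #X ≤ l ^ #D * (2 * m * s) := by gcongr
            _ = _ := by ring
        have hAbig : l ^ m / (2 * m * m) * #X ≤ #A := by
          have h1 := hZbig p hp
          have h2 : (#(Z p) : ℝ) ≤ m * #A := by exact_mod_cast hq
          have h3 : l ^ m / (2 * m * m) * #X = l ^ m / (2 * m) * #X / m := by field_simp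
          rw [h3, div_le_iff₀ (by positivity)]
          linarith
        have hZqbig : l ^ m / (2 * m * m) * #X ≤ #(Z q) := by
          refine le_trans ?_ (hZbig q hqD')
          gcongr ?_ * _
          gcongr l ^ m / ?_
          nlinarith
        have hAZ : A ⊆ Z p := filter_subset _ _
        have hdisj : Disjoint A (Z q) := (hdis p q hqp.symm).mono_left hAZ
        have hne : ∀ v ∈ A, ∀ u ∈ Z q, v ≠ u := fun v hv u hu e =>
          disjoint_left.1 hdisj hv (e ▸ hu)
        have hsum : ∑ v ∈ A, (#{u ∈ Z q | (H.adj p q → T.adj v u) ∧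
            (H.adj q p → T.adj u v)} : ℝ) ≤ lam * #A * #(Z q) := by
          calc _ ≤ ∑ v ∈ A, l * (#(Z q) : ℝ) := sum_le_sum fun v hv => (mem_filter.1 hv).2.2.le
            _ = l * #A * #(Z q) := by rw [sum_const, nsmul_eq_mul]; ring
            _ ≤ _ := by gcongr; exact min_le_left _ _
        rcases H.total p q hqp.symm with hpq | hpq
        · refine absurd ?_ (hno (Z q) (hZX q) A (hAZ.trans (hZX p)) hdisj.symm hZqbig hAbig).not_ge
          rw [sum_card_filter_comm]
          refine le_trans (sum_le_sum fun v hv => ?_) (hsum.trans_eq (by ring))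
          gcongr with u hu
          exact fun h => ⟨fun _ => T.adj_of_not_adj (hne v hv u hu).symm h,
            fun h' => absurd hpq (H.asymm _ _ h')⟩
        · refine absurd ?_ (hno A (hAZ.trans (hZX p)) (Z q) (hZX q) hdisj hAbig hZqbig).not_ge
          refine le_trans (sum_le_sum fun v hv => ?_) hsum
          gcongr with u hu
          exact fun h => ⟨fun h' => absurd hpq (H.asymm _ _ h'),
            fun _ => T.adj_of_not_adj (hne v hv u hu) h⟩
      refine ⟨Function.update f p v, fun q => {u ∈ Z q | (H.adj p q → T.adj v u) ∧
        (H.adj q p → T.adj u v)}, fun q => (filter_subset _ _).trans (hZX q),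
        fun a b hab => (hdis a b hab).mono (filter_subset _ _) (filter_subset _ _),
        fun q hq => ?_, fun a ha b hb hab => ?_, fun a ha b hb u hu => ?_⟩
      · rw [card_insert_of_notMem hp, pow_succ]
        have := hcard q fun e => hq (by simp [e])
        calc l ^ #D * l * s = l * (l ^ #D * s) := by ring
          _ ≤ l * #(Z q) := by gcongr
          _ ≤ _ := hgood q hq
      · have hne : ∀ x ∈ D, x ≠ p := fun x hx e => hp (e ▸ hx)
        rcases mem_insert.1 ha with rfl | ha' <;> rcases mem_insert.1 hb with hb' | hb'
        · exact absurd (hb' ▸ hab) (H.irrefl _)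
        · simpa [Function.update_of_ne (hne b hb')] using (hfZ b hb' _ hp v hv).2 hab
        · subst hb'
          simpa [Function.update_of_ne (hne a ha')] using (hfZ a ha' _ hp v hv).1 hab
        · simpa [Function.update_of_ne (hne a ha'), Function.update_of_ne (hne b hb')] using
            hff a ha' b hb' hab
      · obtain ⟨hu, hu'⟩ := mem_filter.1 hu
        rcases mem_insert.1 ha with rfl | ha
        · simpa using hu'
        · rw [Function.update_of_ne (show a ≠ p from fun e => hp (e ▸ ha))]
          exact hfZ a ha b (fun e => hb (by simp [e])) u hu
  obtain ⟨f, -, -, -, -, hf, -⟩ := key univ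
  exact contains_of_forall_adj f fun u v => hf u (mem_univ _) v (mem_univ _)

lemma IsTransOn.mono {T : Tournament n} {s t : Finset (Fin n)} (h : T.IsTransOn t) (hst : s ⊆ t) :
    T.IsTransOn s := fun u hu v hv w hw => h u (hst hu) v (hst hv) w (hst hw)

lemma IsTransOn.union {T : Tournament n} {s t : Finset (Fin n)} (hs : T.IsTransOn s)
    (ht : T.IsTransOn t) (hst : ∀ u ∈ s, ∀ v ∈ t, T.adj u v) : T.IsTransOn (s ∪ t) := by
  intro u hu v hv w hw huv hvw
  rcases mem_union.1 hu with hu | hu <;> rcases mem_union.1 hv with hv | hv <;>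
    rcases mem_union.1 hw with hw | hw
  · exact hs u hu v hv w hw huv hvw
  · exact hst u hu w hw
  · exact absurd hvw (T.asymm _ _ (hst w hw v hv))
  · exact hst u hu w hw
  · exact absurd huv (T.asymm _ _ (hst v hv u hu))
  · exact absurd huv (T.asymm _ _ (hst v hv u hu))
  · exact absurd hvw (T.asymm _ _ (hst w hw v hv))
  · exact ht u hu v hv w hw huv hvw

lemma exists_isTransOn_of_two_pow_le (T : Tournament n) (k : ℕ) (X : Finset (Fin n))
    (hX : 2 ^ k ≤ #X) : ∃ t ⊆ X, T.IsTransOn t ∧ k + 1 ≤ #t := by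
  induction k generalizing X with
  | zero =>
    obtain ⟨x, hx⟩ := card_pos.1 (Nat.lt_of_lt_of_le one_pos hX)
    refine ⟨{x}, by simpa, fun u hu v hv w hw h => ?_, by simp⟩
    rw [mem_singleton] at hu hv
    exact absurd h (hu ▸ hv ▸ T.irrefl _)
  | succ k ih =>
    obtain ⟨x, hx⟩ := card_pos.1 (Nat.lt_of_lt_of_le (by positivity) hX)
    have hcard := card_filter_add_card_filter_not (s := X.erase x) (fun y => T.adj x y)
    rw [card_erase_of_mem hx] at hcard
    have hsing : T.IsTransOn {x} := fun u hu v hv w hw h => by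
      rw [mem_singleton] at hu hv
      exact absurd h (hu ▸ hv ▸ T.irrefl _)
    rw [pow_succ] at hX
    rcases le_or_gt (2 ^ k) #{y ∈ X.erase x | T.adj x y} with h | h
    · obtain ⟨t, ht, htt, htc⟩ := ih _ h
      have hxt : ∀ y ∈ t, T.adj x y := fun y hy => (mem_filter.1 (ht hy)).2
      refine ⟨{x} ∪ t, union_subset (by simpa) (ht.trans ((filter_subset _ _).trans
        (erase_subset _ _))), hsing.union htt (by simpa using hxt), ?_⟩
      rw [card_union_of_disjoint (by simpa using fun h => T.irrefl _ (hxt _ h)), card_singleton]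
      omega
    · obtain ⟨t, ht, htt, htc⟩ := ih {y ∈ X.erase x | ¬ T.adj x y} (by omega)
      have hxt : ∀ y ∈ t, T.adj y x := fun y hy => by
        obtain ⟨h1, h2⟩ := mem_filter.1 (ht hy)
        exact T.adj_of_not_adj (ne_of_mem_erase h1).symm h2
      refine ⟨t ∪ {x}, union_subset (ht.trans ((filter_subset _ _).trans
        (erase_subset _ _))) (by simpa), htt.union hsing (by simpa using hxt), ?_⟩
      rw [card_union_of_disjoint (by simpa using fun h => T.irrefl _ (hxt _ h)), card_singleton]
      omega

/-- `v` in the `i`-th set and `u` in the `j`-th set of a sequence of sets are joined by an arc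
pointing from the earlier set to the later one; nothing is required when `i = j`. -/
def Fits (T : Tournament n) (i j : ℕ) (v u : Fin n) : Prop :=
  (i < j → T.adj v u) ∧ (j < i → T.adj u v)

lemma card_filter_not_le {α : Type*} {s t : Finset α} (P Q : α → Prop)
    [∀ u, Decidable (¬ P u)] [∀ u, Decidable (¬ Q u)] (hst : s ⊆ t) (h : ∀ u, Q u → P u) :
    (#{u ∈ s | ¬ P u} : ℝ) ≤ #{u ∈ t | ¬ Q u} := by
  refine Nat.cast_le.2 (card_le_card fun u hu => ?_)
  rw [mem_filter] at hu ⊢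
  exact ⟨hst hu.1, fun hq => hu.2 (h u hq)⟩

lemma exists_structure (H : Tournament m) (k : ℕ) : ∀ (w : ℕ → Prop) {lam : ℝ}, 0 < lam →
    ∃ c : ℝ, 0 < c ∧ c ≤ 1 ∧ ∃ N : ℕ, ∀ {n : ℕ} (T : Tournament n), ¬ T.Contains H →
      ∀ ε : ℝ, 0 < ε → ε ≤ 1 → ∀ X : Finset (Fin n),
        (∀ Y ⊆ X, ∃ t ⊆ Y, T.IsTransOn t ∧ (#Y : ℝ) ^ ε ≤ #t) → N ≤ #X →
        ∃ S : ℕ → Finset (Fin n), (∀ i < k, S i ⊆ X) ∧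
          (∀ i < k, ¬ w i → c * #X ≤ #(S i)) ∧
          (∀ i < k, w i → T.IsTransOn (S i) ∧ c * (#X : ℝ) ^ ε ≤ #(S i)) ∧
          (∀ i < k, ∀ j < k, i ≠ j → Disjoint (S i) (S j)) ∧
          ∀ i < k, ∀ j < k, ∀ v ∈ S i, (#{u ∈ S j | ¬ T.Fits i j v u} : ℝ) ≤ lam * #(S j) := by
  induction k with
  | zero => exact fun w lam _ => ⟨1, one_pos, le_rfl, 0, fun T _ ε _ _ X _ _ =>
      ⟨fun _ => ∅, by simp⟩⟩
  | succ k ih =>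
    intro w lam hlam
    obtain ⟨c₁, hc₁, hc₁1, N₁, h₁⟩ := ih (fun i => w (i + 1)) (lam := lam / 2) (by positivity)
    obtain ⟨c₂, hc₂, hc₂1, N₂, h₂⟩ := exists_dense_pair H (lam := lam / (16 * (k + 1)))
      (by positivity)
    set μ := lam / (16 * (k + 1)) with hμ
    have hμ0 : 0 < μ := by positivity
    refine ⟨c₁ * c₂ / 4, by positivity, by nlinarith, max (max N₂ 1) ⌈2 * N₁ / c₂⌉₊,
      fun {n} T hT ε hε hε1 X hX hN => ?_⟩
    have hNX : (2 * N₁ / c₂ : ℝ) ≤ #X :=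
      (Nat.le_ceil _).trans (by exact_mod_cast (le_max_right _ _).trans hN)
    rw [div_le_iff₀ hc₂] at hNX
    have hX1 : (1 : ℝ) ≤ #X := by
      exact_mod_cast (le_max_right _ _).trans ((le_max_left _ _).trans hN)
    obtain ⟨A, hAX, B, hBX, hAB, hAc, hBc, hsum⟩ :=
      h₂ T hT X ((le_max_left _ _).trans ((le_max_left _ _).trans hN))
    rw [sum_card_filter_comm] at hsum
    set B' := {b ∈ B | (#{a ∈ A | ¬ T.adj a b} : ℝ) ≤ 2 * μ * #A} with hB'
    have hB'B : B' ⊆ B := filter_subset _ _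
    have hB'card : (#B : ℝ) ≤ 2 * #B' :=
      card_le_two_mul_card_filter (fun b a => ¬ T.adj a b) B A hμ0 (hsum.trans_eq (by ring))
    obtain ⟨S, hSB, hSlin, hStr, hSd, hS⟩ := h₁ T hT ε hε hε1 B'
      (fun Y hY => hX Y (hY.trans (hB'B.trans hBX)))
      (by have : (N₁ : ℝ) ≤ #B' := by nlinarith
          exact_mod_cast this)
    -- the vertices of `A` that are complete to most of each `S i`
    set A' := {a ∈ A | ∀ i < k, (#{u ∈ S i | ¬ T.adj a u} : ℝ) ≤ lam / 4 * #(S i)} with hA'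
    have hA'A : A' ⊆ A := filter_subset _ _
    have hbad : ∀ i < k, (#{a ∈ A | lam / 4 * #(S i) < (#{u ∈ S i | ¬ T.adj a u} : ℝ)} : ℝ)
        * (lam / 4) ≤ 2 * μ * #A := fun i hi => by
      refine card_filter_mul_le (fun a u => ¬ T.adj a u) A (S i) (by positivity) ?_
      rw [sum_card_filter_comm]
      calc _ ≤ ∑ u ∈ S i, 2 * μ * (#A : ℝ) :=
            sum_le_sum fun u hu => (mem_filter.1 (hSB i hi hu)).2
        _ = _ := by rw [sum_const, nsmul_eq_mul]; ring
    have hA'card : (#A : ℝ) ≤ 2 * #A' := by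
      have hsub : A \ A' ⊆ (range k).biUnion fun i =>
          {a ∈ A | lam / 4 * #(S i) < (#{u ∈ S i | ¬ T.adj a u} : ℝ)} := fun a ha => by
        obtain ⟨ha, ha'⟩ := mem_sdiff.1 ha
        simp only [hA', mem_filter, ha, true_and, not_forall, not_le] at ha'
        obtain ⟨i, hi, h⟩ := ha'
        exact mem_biUnion.2 ⟨i, mem_range.2 hi, mem_filter.2 ⟨ha, h⟩⟩
      have h3 : (#(A \ A') : ℝ) ≤ ∑ i ∈ range k,
          (#{a ∈ A | lam / 4 * #(S i) < (#{u ∈ S i | ¬ T.adj a u} : ℝ)} : ℝ) := by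
        exact_mod_cast (card_le_card hsub).trans card_biUnion_le
      have h4 : (#(A \ A') : ℝ) * (lam / 4) ≤ k * (2 * μ * #A) := by
        calc _ ≤ (∑ i ∈ range k, (#{a ∈ A | lam / 4 * #(S i) <
              (#{u ∈ S i | ¬ T.adj a u} : ℝ)} : ℝ)) * (lam / 4) := by gcongr
          _ ≤ ∑ i ∈ range k, 2 * μ * (#A : ℝ) := by
            rw [sum_mul]; exact sum_le_sum fun i hi => hbad i (mem_range.1 hi)
          _ = _ := by rw [sum_const, nsmul_eq_mul, card_range]
      have h5 : (#(A \ A') : ℝ) + #A' = #A := by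
        exact_mod_cast card_sdiff_add_card_eq_card hA'A
      have h6 : lam = μ * (16 * (k + 1)) := by rw [hμ]; field_simp
      rw [h6] at h4
      have h7 : (#(A \ A') : ℝ) * (2 * (k + 1)) ≤ k * #A := by
        refine le_of_mul_le_mul_left (a := 2 * μ) ?_ (by positivity)
        linarith
      have h8 : (0 : ℝ) ≤ #(A \ A') := Nat.cast_nonneg _
      have h9 : (0 : ℝ) ≤ #A := Nat.cast_nonneg _
      by_contra! hlt
      have hk : (0 : ℝ) ≤ k := by positivity
      nlinarith [mul_nonneg hk h9]
    -- the first set of the structure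
    obtain ⟨R, hRA, hRlin, hRtr⟩ : ∃ R ⊆ A', (¬ w 0 → c₁ * c₂ / 4 * #X ≤ #R) ∧
        (w 0 → T.IsTransOn R ∧ c₁ * c₂ / 4 * (#X : ℝ) ^ ε ≤ #R) := by
      by_cases h0 : w 0
      · obtain ⟨t, ht, htt, htc⟩ := hX A' (hA'A.trans hAX)
        refine ⟨t, ht, fun h => absurd h0 h, fun _ => ⟨htt, le_trans ?_ htc⟩⟩
        calc c₁ * c₂ / 4 * (#X : ℝ) ^ ε ≤ (c₂ / 2) ^ ε * (#X : ℝ) ^ ε := by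
              gcongr
              refine le_trans ?_ (Real.self_le_rpow_of_le_one (by positivity) (by linarith) hε1)
              nlinarith
          _ = (c₂ / 2 * #X) ^ ε := by rw [Real.mul_rpow (by positivity) (by positivity)]
          _ ≤ _ := by gcongr; linarith
      · refine ⟨A', Subset.rfl, fun _ => ?_, fun h => absurd h h0⟩
        have : c₁ * c₂ / 4 * #X ≤ c₂ / 2 * #X :=
          mul_le_mul_of_nonneg_right (by nlinarith) (Nat.cast_nonneg _)
        linarith
    set S' : ℕ → Finset (Fin n) := fun i =>
      {u ∈ S i | (#{v ∈ R | ¬ T.adj v u} : ℝ) ≤ 2 * (lam / 4) * #R} with hS'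
    have hS'S : ∀ i, S' i ⊆ S i := fun i => filter_subset _ _
    have hRS : ∀ i < k, ∀ v ∈ R, (#{u ∈ S i | ¬ T.adj v u} : ℝ) ≤ lam / 4 * #(S i) :=
      fun i hi v hv => (mem_filter.1 (hRA hv)).2 i hi
    have hS'card : ∀ i < k, (#(S i) : ℝ) ≤ 2 * #(S' i) := fun i hi => by
      refine card_le_two_mul_card_filter (fun u v => ¬ T.adj v u) (S i) R (by positivity) ?_
      rw [← sum_card_filter_comm]
      calc _ ≤ ∑ v ∈ R, lam / 4 * (#(S i) : ℝ) := sum_le_sum fun v hv => hRS i hi v hv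
        _ = _ := by rw [sum_const, nsmul_eq_mul]; ring
    have hSX : ∀ i < k, S' i ⊆ B := fun i hi => (hS'S i).trans ((hSB i hi).trans hB'B)
    refine ⟨fun i => i.casesOn R S', fun i hi => ?_, fun i hi hw => ?_, fun i hi hw => ?_,
      fun i hi j hj hij => ?_, fun i hi j hj v hv => ?_⟩
    · cases i with
      | zero => exact hRA.trans (hA'A.trans hAX)
      | succ i => exact (hSX i (by omega)).trans hBX
    · cases i with
      | zero => exact hRlin hw
      | succ i =>
        have h1 := hSlin i (by omega) hw
        have h2 := hS'card i (by omega)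
        have h3 : c₁ * (c₂ / 2 * #X) ≤ c₁ * #B' := by gcongr; linarith
        change c₁ * c₂ / 4 * #X ≤ (#(S' i) : ℝ)
        linarith
    · cases i with
      | zero => exact hRtr hw
      | succ i =>
        obtain ⟨h0, h1⟩ := hStr i (by omega) hw
        have h2 := hS'card i (by omega)
        refine ⟨h0.mono (hS'S i), ?_⟩
        have h3 : c₁ * (c₂ / 2 * (#X : ℝ) ^ ε) ≤ c₁ * (#B' : ℝ) ^ ε := by
          gcongr
          calc c₂ / 2 * (#X : ℝ) ^ ε ≤ (c₂ / 2) ^ ε * (#X : ℝ) ^ ε := by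
                gcongr
                exact Real.self_le_rpow_of_le_one (by positivity) (by linarith) hε1
            _ = (c₂ / 2 * #X) ^ ε := by rw [Real.mul_rpow (by positivity) (by positivity)]
            _ ≤ _ := by gcongr; linarith
        change c₁ * c₂ / 4 * (#X : ℝ) ^ ε ≤ (#(S' i) : ℝ)
        linarith
    · have hRS' : ∀ i < k, Disjoint R (S' i) := fun i hi =>
        hAB.mono (hRA.trans hA'A) (hSX i hi)
      cases i with
      | zero =>
        cases j with
        | zero => exact absurd rfl hij
        | succ j => exact hRS' j (by omega)
      | succ i =>
        cases j with
        | zero => exact (hRS' i (by omega)).symm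
        | succ j =>
          exact (hSd i (by omega) j (by omega) (by omega)).mono (hS'S i) (hS'S j)
    · cases i with
      | zero =>
        cases j with
        | zero => simp [Fits]; positivity
        | succ j =>
          have h1 := hRS j (by omega) v hv
          have h2 := mul_le_mul_of_nonneg_left (hS'card j (by omega)) hlam.le
          have h3 : (#{u ∈ S' j | ¬ T.Fits 0 (j + 1) v u} : ℝ) ≤ #{u ∈ S j | ¬ T.adj v u} :=
            card_filter_not_le (T.Fits 0 (j + 1) v) (T.adj v) (hS'S j) fun u h =>
              ⟨fun _ => h, fun h => absurd h (Nat.not_lt_zero _)⟩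
          exact h3.trans (show _ ≤ lam * (#(S' j) : ℝ) by linarith)
      | succ i =>
        cases j with
        | zero =>
          have h1 := (mem_filter.1 hv).2
          have h2 : (#{u ∈ R | ¬ T.Fits (i + 1) 0 v u} : ℝ) ≤ #{u ∈ R | ¬ T.adj u v} :=
            card_filter_not_le (T.Fits (i + 1) 0 v) (fun u => T.adj u v) Subset.rfl fun u h =>
              ⟨fun h => absurd h (Nat.not_lt_zero _), fun _ => h⟩
          have h3 : 0 ≤ lam * #R := by positivity
          exact h2.trans (h1.trans (show _ ≤ lam * (#R : ℝ) by linarith))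
        | succ j =>
          have h1 := hS i (by omega) j (by omega) v (hS'S i hv)
          have h2 := mul_le_mul_of_nonneg_left (hS'card j (by omega)) hlam.le
          have h3 : (#{u ∈ S' j | ¬ T.Fits (i + 1) (j + 1) v u} : ℝ) ≤
              #{u ∈ S j | ¬ T.Fits i j v u} :=
            card_filter_not_le (T.Fits (i + 1) (j + 1) v) (T.Fits i j v) (hS'S j) fun u h =>
              ⟨fun hij => h.1 (by omega), fun hij => h.2 (by omega)⟩
          exact h3.trans (show _ ≤ lam * (#(S' j) : ℝ) by linarith)

lemma exists_small_exponent {δ : ℝ} (hδ : 0 < δ) {N : ℝ} (hN : 0 < N) :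
    ∃ ε : ℝ, 0 < ε ∧ ε ≤ 1 ∧ 1 - δ ≤ δ ^ ε ∧ N ^ ε ≤ 2 := by
  have h1 : Filter.Tendsto (fun ε : ℝ => δ ^ ε) (nhdsWithin 0 (Set.Ioi 0)) (nhds 1) := by
    have := (Real.continuousAt_const_rpow (b := 0) hδ.ne').tendsto
    rw [Real.rpow_zero] at this
    exact this.mono_left nhdsWithin_le_nhds
  have h2 : Filter.Tendsto (fun ε : ℝ => N ^ ε) (nhdsWithin 0 (Set.Ioi 0)) (nhds 1) := by
    have := (Real.continuousAt_const_rpow (b := 0) hN.ne').tendsto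
    rw [Real.rpow_zero] at this
    exact this.mono_left nhdsWithin_le_nhds
  obtain ⟨ε, ⟨⟨h3, h4⟩, h5⟩, h6⟩ := (((h1.eventually_const_le (show 1 - δ < 1 by linarith)).and
    (h2.eventually_le_const (show (1 : ℝ) < 2 by norm_num))).and
    (nhdsWithin_le_nhds (eventually_le_nhds (show (0 : ℝ) < 1 by norm_num)))).and
    self_mem_nhdsWithin |>.exists
  exact ⟨ε, h6, h5, h3, h4⟩

/-- Sets `S 0, …, S (K - 1)`, transitive when `w i` holds, such that almost all arcs between any
two of them point forward, while large subsets of two different ones, not both transitive, are not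
complete to each other. -/
structure IsScheme (T : Tournament n) (w : ℕ → Prop) (K q L C : ℕ) (S : ℕ → Finset (Fin n)) :
    Prop where
  fits : ∀ i < K, ∀ j < K, ∀ v ∈ S i, L * #{u ∈ S j | ¬ T.Fits i j v u} ≤ #(S j)
  exists_adj : ∀ i < K, ∀ j < K, i ≠ j → (¬ w i ∨ ¬ w j) → ∀ A ⊆ S i, ∀ B ⊆ S j,
    #(S i) ≤ q * #A → #(S j) ≤ q * #B → ∃ a ∈ A, ∃ b ∈ B, T.adj a b
  isTransOn : ∀ i < K, w i → T.IsTransOn (S i)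
  le_card : ∀ i < K, C ≤ #(S i)

lemma exists_isScheme (H : Tournament m) (w : ℕ → Prop) (K q L C : ℕ) :
    ∃ ε : ℝ, 0 < ε ∧ ∀ {n : ℕ} (T : Tournament n), ¬ T.Contains H → ∀ X : Finset (Fin n),
      (∀ t ⊆ X, T.IsTransOn t → (#t : ℝ) < (#X : ℝ) ^ ε) →
      (∀ Y, Y ⊂ X → ∃ t ⊆ Y, T.IsTransOn t ∧ (#Y : ℝ) ^ ε ≤ #t) →
      ∃ S : ℕ → Finset (Fin n), T.IsScheme w K q L C S := by
  obtain ⟨c, hc, hc1, N, hstr⟩ := exists_structure H K w (lam := 1 / (L + 1)) (by positivity)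
  set δ : ℝ := c / (2 * (q + 1)) with hδ
  have hδ0 : 0 < δ := by positivity
  have hδq : δ * (q + 1) = c / 2 := by rw [hδ]; field_simp
  have hq0 : (0 : ℝ) ≤ q := Nat.cast_nonneg _
  have hδ1 : δ ≤ 1 := by nlinarith
  obtain ⟨k, hk⟩ := exists_nat_ge (2 * C / c)
  rw [div_le_iff₀ hc] at hk
  obtain ⟨ε, hε, hε1, hεδ, hεN⟩ := exists_small_exponent hδ0
    (show (0 : ℝ) < (max (2 * N) (2 ^ k) : ℕ) by
      exact_mod_cast (lt_max_of_lt_right (by positivity)))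
  refine ⟨ε, hε, fun {n} T hT X htr hX => ?_⟩
  set M : ℝ := (#X : ℝ) ^ ε with hM
  have hX1 : 1 ≤ #X := by
    by_contra! h
    have h0 : #X = 0 := by omega
    have := htr ∅ (empty_subset _) (by simp [IsTransOn])
    rw [hM, h0, Nat.cast_zero, Real.zero_rpow hε.ne'] at this
    simp at this
  have hram : ∀ j : ℕ, 2 ^ j ≤ #X → (j : ℝ) + 1 < M := fun j hj => by
    obtain ⟨t, ht, htt, htc⟩ := T.exists_isTransOn_of_two_pow_le j X hj
    have h : ((j + 1 : ℕ) : ℝ) ≤ #t := by exact_mod_cast htc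
    push_cast at h
    exact h.trans_lt (htr t ht htt)
  have hX2 : 2 ≤ #X := by
    by_contra! h
    have h0 : #X = 1 := by omega
    have := hram 0 (by omega)
    rw [hM, h0] at this
    simp at this
  have hXN : max (2 * N) (2 ^ k) ≤ #X := by
    by_contra! h
    have h1 : M ≤ ((max (2 * N) (2 ^ k) : ℕ) : ℝ) ^ ε := by
      rw [hM]; gcongr
    have h2 := hram 1 (by simpa using hX2)
    norm_num at h2
    linarith
  have hMk := hram k ((le_max_right _ _).trans hXN)
  have hX1' : (1 : ℝ) ≤ #X := by exact_mod_cast hX1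
  have hMX : M ≤ #X := by
    simpa using Real.rpow_le_rpow_of_exponent_le hX1' hε1
  have hM0 : 0 ≤ M := by positivity
  have hMC : (C : ℝ) ≤ c / 2 * M := by nlinarith
  obtain ⟨x, hx⟩ := card_pos.1 hX1
  have hss : ∀ Y ⊆ X.erase x, Y ⊂ X := fun Y hY => hY.trans_ssubset (erase_ssubset hx)
  have hcard : #(X.erase x) + 1 = #X := card_erase_add_one hx
  have hXN' := (le_max_left _ _).trans hXN
  have hhalf : (1 / 2 : ℝ) * #X ≤ #(X.erase x) := by
    have : #X ≤ 2 * #(X.erase x) := by omega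
    have : (#X : ℝ) ≤ 2 * #(X.erase x) := by exact_mod_cast this
    linarith
  obtain ⟨S, hSX, hSlin, hStr, hSd, hS⟩ := hstr T hT ε hε hε1 (X.erase x)
    (fun Y hY => hX Y (hss Y hY)) (by omega)
  have hrpow : ∀ a : ℝ, 0 ≤ a → (a * #X) ^ ε = a ^ ε * M := fun a ha => by
    rw [Real.mul_rpow ha (by positivity)]
  have hlin : ∀ i < K, ¬ w i → c / 2 * #X ≤ #(S i) := fun i hi hw => by
    refine le_trans ?_ (hSlin i hi hw)
    nlinarith
  have htrans : ∀ i < K, w i → c / 2 * M ≤ #(S i) := fun i hi hw => by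
    refine le_trans ?_ (hStr i hi hw).2
    have h1 : (1 / 2 : ℝ) * M ≤ (#(X.erase x) : ℝ) ^ ε := by
      calc (1 / 2 : ℝ) * M ≤ (1 / 2 : ℝ) ^ ε * M := by
            gcongr
            exact Real.self_le_rpow_of_le_one (by norm_num) (by norm_num) hε1
        _ = (1 / 2 * #X : ℝ) ^ ε := (hrpow _ (by norm_num)).symm
        _ ≤ _ := by gcongr
    nlinarith
  have hlarge : ∀ (i : ℕ) (A : Finset (Fin n)) (a : ℝ), 0 ≤ a → c / 2 * a ≤ #(S i) →
      #(S i) ≤ q * #A → δ * a ≤ #A := fun i A a ha h1 h2 => by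
    have h3 : (#(S i) : ℝ) ≤ q * #A := by exact_mod_cast h2
    have h4 : (0 : ℝ) ≤ #A := Nat.cast_nonneg _
    rw [← hδq] at h1
    by_contra! hlt
    nlinarith [mul_le_mul_of_nonneg_left hlt.le hq0, mul_nonneg hδ0.le ha]
  have hkey : ∀ A ⊆ X.erase x, ∀ B ⊆ X.erase x, Disjoint A B → δ * #X ≤ #A → T.IsTransOn B →
      δ * M ≤ #B → ¬ (∀ a ∈ A, ∀ b ∈ B, T.adj a b) ∧ ¬ (∀ a ∈ A, ∀ b ∈ B, T.adj b a) := by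
    intro A hA B hB hAB hAc hBt hBc
    obtain ⟨t, htA, htt, htc⟩ := hX A (hss A hA)
    have h1 : (1 - δ) * M ≤ #t := by
      calc (1 - δ) * M ≤ δ ^ ε * M := by gcongr
        _ = (δ * #X) ^ ε := (hrpow _ hδ0.le).symm
        _ ≤ (#A : ℝ) ^ ε := by gcongr
        _ ≤ _ := htc
    have h2 : (#(t ∪ B) : ℝ) = #t + #B := by
      exact_mod_cast card_union_of_disjoint (hAB.mono_left htA)
    have h3 : t ∪ B ⊆ X := union_subset (htA.trans (hss A hA).1) (hss B hB).1
    refine ⟨fun h => ?_, fun h => ?_⟩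
    · have := htr _ h3 (htt.union hBt fun u hu v hv => h u (htA hu) v hv)
      linarith
    · have := htr _ h3 (union_comm B t ▸ hBt.union htt fun u hu v hv => h v (htA hv) u hu)
      linarith
  refine ⟨S, fun i hi j hj v hv => ?_, fun i hi j hj hij hw A hA B hB hAc hBc => ?_,
    fun i hi hw => (hStr i hi hw).1, fun i hi => ?_⟩
  · have h := hS i hi j hj v hv
    rw [one_div_mul_eq_div, le_div_iff₀ (by positivity)] at h
    have h0 : (0 : ℝ) ≤ #{u ∈ S j | ¬ T.Fits i j v u} := Nat.cast_nonneg _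
    have h1 : (L : ℝ) * #{u ∈ S j | ¬ T.Fits i j v u} ≤ #(S j) := by linarith
    exact_mod_cast h1
  · by_contra! hno
    have hAX := hA.trans (hSX i hi)
    have hBX := hB.trans (hSX j hj)
    have hdis : Disjoint A B := (hSd i hi j hj hij).mono hA hB
    have hBA : ∀ a ∈ A, ∀ b ∈ B, T.adj b a := fun a ha b hb =>
      T.adj_of_not_adj (fun e => disjoint_left.1 hdis ha (e ▸ hb)) (hno a ha b hb)
    by_cases hwi : w i
    · have hwj : ¬ w j := hw.resolve_left (not_not.2 hwi)
      exact (hkey B hBX A hAX hdis.symm (hlarge j B _ (by positivity) (hlin j hj hwj) hBc)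
        ((hStr i hi hwi).1.mono hA) (hlarge i A _ hM0 (htrans i hi hwi) hAc)).1
        fun b hb a ha => hBA a ha b hb
    · have hAl := hlarge i A _ (by positivity) (hlin i hi hwi) hAc
      by_cases hwj : w j
      · exact (hkey A hAX B hBX hdis hAl ((hStr j hj hwj).1.mono hB)
          (hlarge j B _ hM0 (htrans j hj hwj) hBc)).2 hBA
      · have hBl := hlarge j B _ (by positivity) (hlin j hj hwj) hBc
        obtain ⟨t, htB, htt, htc⟩ := hX B (hss B hBX)
        refine (hkey A hAX t (htB.trans hBX) (hdis.mono_right htB) hAl htt ?_).2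
          fun a ha b hb => hBA a ha b (htB hb)
        calc δ * M ≤ δ ^ ε * M := by
              gcongr
              exact Real.self_le_rpow_of_le_one hδ0.le hδ1 hε1
          _ = (δ * #X) ^ ε := (hrpow _ hδ0.le).symm
          _ ≤ (#B : ℝ) ^ ε := by gcongr
          _ ≤ _ := htc
  · have h1 : (C : ℝ) ≤ #(S i) := by
      by_cases hw : w i
      · exact hMC.trans (htrans i hi hw)
      · refine hMC.trans (le_trans ?_ (hlin i hi hw))
        gcongr
    exact_mod_cast h1

lemma IsTransOn.exists_source {T : Tournament n} {s : Finset (Fin n)} (hs : T.IsTransOn s)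
    (hne : s.Nonempty) : ∃ x ∈ s, ∀ y ∈ s, y ≠ x → T.adj x y := by
  induction hne using Finset.Nonempty.cons_induction with
  | singleton a => exact ⟨a, by simp, by simp⟩
  | cons a s ha hne ih =>
    have hsub : s ⊆ cons a s ha := subset_cons ha
    obtain ⟨x, hx, hsrc⟩ := ih (hs.mono hsub)
    have hax : a ≠ x := fun e => ha (e ▸ hx)
    rcases T.total a x hax with h | h
    · refine ⟨a, mem_cons_self a s, fun y hy hya => ?_⟩
      have hys := (mem_cons.1 hy).resolve_left hya
      rcases eq_or_ne y x with rfl | hyx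
      · exact h
      · exact hs a (mem_cons_self a s) x (hsub hx) y hy h (hsrc y hys hyx)
    · refine ⟨x, hsub hx, fun y hy hyx => ?_⟩
      rcases mem_cons.1 hy with rfl | hys
      · exact h
      · exact hsrc y hys hyx

lemma IsTransOn.exists_initial {T : Tournament n} {s : Finset (Fin n)} (hs : T.IsTransOn s)
    (k : ℕ) (hk : k ≤ #s) : ∃ P ⊆ s, #P = k ∧ ∀ u ∈ P, ∀ v ∈ s \ P, T.adj u v := by
  induction k with
  | zero => exact ⟨∅, empty_subset _, rfl, by simp⟩
  | succ k ih =>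
    obtain ⟨P, hP, hPk, hadj⟩ := ih (by omega)
    have hne : (s \ P).Nonempty := by
      rw [← card_pos, card_sdiff_of_subset hP]; omega
    obtain ⟨x, hx, hsrc⟩ := (hs.mono sdiff_subset).exists_source hne
    rw [mem_sdiff] at hx
    refine ⟨insert x P, insert_subset hx.1 hP, by rw [card_insert_of_notMem hx.2, hPk],
      fun u hu v hv => ?_⟩
    rw [mem_sdiff, mem_insert, not_or] at hv
    have hv' : v ∈ s \ P := mem_sdiff.2 ⟨hv.1, hv.2.2⟩
    rcases mem_insert.1 hu with rfl | hu
    · exact hsrc v hv' hv.2.1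
    · exact hadj u hu v hv'

lemma IsTransOn.exists_pieces {T : Tournament n} (a : ℕ) (k : ℕ) : ∀ {s : Finset (Fin n)},
    T.IsTransOn s → k * a ≤ #s → ∃ P : ℕ → Finset (Fin n), (∀ i < k, P i ⊆ s ∧ #(P i) = a) ∧
      ∀ i < k, ∀ j < k, i < j → ∀ u ∈ P i, ∀ v ∈ P j, T.adj u v := by
  induction k with
  | zero => exact fun _ _ => ⟨fun _ => ∅, by simp, by simp⟩
  | succ k ih =>
    intro s hs hk
    rw [Nat.succ_mul] at hk
    obtain ⟨P, hP, hPa, hadj⟩ := hs.exists_initial a (by omega)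
    obtain ⟨R, hR, hRadj⟩ := ih (hs.mono sdiff_subset : T.IsTransOn (s \ P))
      (by rw [card_sdiff_of_subset hP]; omega)
    refine ⟨fun i => i.casesOn P R, fun i hi => ?_, fun i hi j hj hij u hu v hv => ?_⟩
    · cases i with
      | zero => exact ⟨hP, hPa⟩
      | succ i => exact ⟨(hR i (by omega)).1.trans sdiff_subset, (hR i (by omega)).2⟩
    · cases j with
      | zero => omega
      | succ j =>
        cases i with
        | zero => exact hadj u hu v ((hR j (by omega)).1 hv)
        | succ i => exact hRadj i (by omega) j (by omega) (by omega) u hu v hv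

lemma IsScheme.exists_pieces {T : Tournament n} {w : ℕ → Prop} {K q L : ℕ}
    {S : ℕ → Finset (Fin n)} (hS : T.IsScheme w K q L (2 * m) S) (hm : 0 < m) :
    ∃ P : ℕ → ℕ → Finset (Fin n), ∀ i < K,
      (∀ j < 2 * m, P i j ⊆ S i ∧ #(S i) ≤ 4 * m * #(P i j)) ∧
      (¬ w i → ∀ j, P i j = S i) ∧
      (w i → ∀ j < 2 * m, ∀ j' < 2 * m, j < j' → ∀ u ∈ P i j, ∀ v ∈ P i j', T.adj u v) := by
  have h : ∀ i, ∃ P : ℕ → Finset (Fin n), i < K →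
      (∀ j < 2 * m, P j ⊆ S i ∧ #(S i) ≤ 4 * m * #(P j)) ∧
      (¬ w i → ∀ j, P j = S i) ∧
      (w i → ∀ j < 2 * m, ∀ j' < 2 * m, j < j' → ∀ u ∈ P j, ∀ v ∈ P j', T.adj u v) := by
    intro i
    by_cases hi : i < K
    · by_cases hw : w i
      · obtain ⟨P, hP, hadj⟩ := (hS.isTransOn i hi hw).exists_pieces (#(S i) / (2 * m)) (2 * m)
          (Nat.mul_div_le _ _)
        refine ⟨P, fun _ => ⟨fun j hj => ⟨(hP j hj).1, ?_⟩, fun h => absurd hw h, fun _ => hadj⟩⟩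
        rw [(hP j hj).2]
        have h1 : 1 ≤ #(S i) / (2 * m) := (Nat.one_le_div_iff (by omega)).2 (hS.le_card i hi)
        have h2 : #(S i) < 2 * m * (#(S i) / (2 * m) + 1) :=
          Nat.lt_mul_div_succ _ (by omega)
        nlinarith
      · refine ⟨fun _ => S i, fun _ => ⟨fun j _ => ⟨Subset.rfl, ?_⟩, fun _ _ => rfl,
          fun h => absurd h hw⟩⟩
        nlinarith [Nat.zero_le #(S i)]
    · exact ⟨fun _ => ∅, fun h => absurd h hi⟩
  choose P hP using h
  exact ⟨P, hP⟩

/-- `Z` is a subset of `s` that misses at most a fraction `r / L` of it. -/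
def IsMost (L r : ℕ) (s Z : Finset (Fin n)) : Prop :=
  Z ⊆ s ∧ L * #(s \ Z) ≤ r * #s

lemma IsMost.card_le_mul_card_inter {r : ℕ} {s Z Q : Finset (Fin n)} (hm : 0 < m)
    (h : IsMost (8 * m * (m + 2)) r s Z) (hr : r ≤ m + 2) (hQ : Q ⊆ s) (hQc : #s ≤ 4 * m * #Q) :
    #s ≤ 8 * m * #(Q ∩ Z) := by
  have h1 : 8 * m * #(s \ Z) ≤ #s := by
    refine Nat.le_of_mul_le_mul_left (?_ : (m + 2) * _ ≤ (m + 2) * _) (by omega)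
    calc (m + 2) * (8 * m * #(s \ Z)) = 8 * m * (m + 2) * #(s \ Z) := by ring
      _ ≤ r * #s := h.2
      _ ≤ _ := Nat.mul_le_mul_right _ hr
  have h2 : #Q ≤ #(Q ∩ Z) + #(s \ Z) := by
    rw [← card_inter_add_card_sdiff Q Z]
    exact Nat.add_le_add_left (card_le_card (sdiff_subset_sdiff hQ Subset.rfl)) _
  nlinarith [Nat.mul_le_mul_left (8 * m) h2]

lemma IsMost.card_le {r : ℕ} {s Z : Finset (Fin n)} (hm : 0 < m)
    (h : IsMost (8 * m * (m + 2)) r s Z) (hr : r ≤ m + 2) : #s ≤ 8 * m * #Z := by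
  have := h.card_le_mul_card_inter hm hr Subset.rfl (by nlinarith [Nat.zero_le #s])
  rwa [inter_eq_right.2 h.1] at this

lemma IsMost.filter_fits {T : Tournament n} {w : ℕ → Prop} {K q L C r : ℕ}
    {S : ℕ → Finset (Fin n)} {i j : ℕ} {Z : Finset (Fin n)} {v : Fin n}
    (h : IsMost L r (S j) Z) (hS : T.IsScheme w K q L C S) (hi : i < K) (hj : j < K)
    (hv : v ∈ S i) : IsMost L (r + 1) (S j) {u ∈ Z | T.Fits i j v u} := by
  refine ⟨(filter_subset _ _).trans h.1, ?_⟩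
  have h1 : S j \ {u ∈ Z | T.Fits i j v u} ⊆ (S j \ Z) ∪ {u ∈ S j | ¬ T.Fits i j v u} := by
    intro u hu
    simp only [mem_sdiff, mem_filter, mem_union, not_and] at hu ⊢
    by_cases huZ : u ∈ Z
    · exact Or.inr ⟨hu.1, hu.2 huZ⟩
    · exact Or.inl ⟨hu.1, huZ⟩
  have h2 := (card_le_card h1).trans (card_union_le _ _)
  have h3 := hS.fits i hi j hj v hv
  have h4 := h.2
  nlinarith [Nat.mul_le_mul_left L h2]

lemma IsScheme.contains_of_groups {T : Tournament n} {H : Tournament m} {w : ℕ → Prop}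
    {K q L C : ℕ} {S : ℕ → Finset (Fin n)} (hS : T.IsScheme w K q L C S) {γ : Type*} [Fintype γ]
    (grp : Fin m → γ) (idx : Fin m → ℕ) (slot : Fin m → Finset (Fin n)) (hidx : ∀ v, idx v < K)
    (hslot : ∀ v, slot v ⊆ S (idx v))
    (hcross : ∀ u v, grp u ≠ grp v → H.adj u v →
      idx u < idx v ∨ idx u = idx v ∧ ∀ x ∈ slot u, ∀ y ∈ slot v, T.adj x y)
    (hgrp : ∀ (g : γ) (Z : ℕ → Finset (Fin n)), (∀ i < K, IsMost L m (S i) (Z i)) →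
      ∃ f : Fin m → Fin n, (∀ v, grp v = g → f v ∈ slot v ∧ f v ∈ Z (idx v)) ∧
        ∀ u v, grp u = g → grp v = g → H.adj u v → T.adj (f u) (f v))
    (hX : Nonempty (Fin n)) : T.Contains H := by
  have key : ∀ D : Finset γ, ∃ f : Fin m → Fin n, (∀ v, grp v ∈ D → f v ∈ slot v) ∧
      ∀ u v, grp u ∈ D → grp v ∈ D → H.adj u v → T.adj (f u) (f v) := by
    intro D
    induction D using Finset.induction_on with
    | empty => exact ⟨fun _ => hX.some, by simp, by simp⟩
    | insert g D hg ih =>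
      obtain ⟨f, hf, hff⟩ := ih
      obtain ⟨f', hf', hff'⟩ := hgrp g
        (fun i => {x ∈ S i | ∀ p, grp p ∈ D → T.Fits (idx p) i (f p) x}) (fun i hi => by
          refine ⟨filter_subset _ _, ?_⟩
          have h1 : S i \ {x ∈ S i | ∀ p, grp p ∈ D → T.Fits (idx p) i (f p) x} ⊆
              ({p | grp p ∈ D} : Finset (Fin m)).biUnion
                fun p => {x ∈ S i | ¬ T.Fits (idx p) i (f p) x} := by
            intro x hx
            simp only [mem_sdiff, mem_filter, not_and, not_forall] at hx
            obtain ⟨p, hp, hfit⟩ := hx.2 hx.1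
            simp only [mem_biUnion, mem_filter, mem_univ, true_and]
            exact ⟨p, hp, hx.1, hfit⟩
          calc _ ≤ L * ∑ p with grp p ∈ D, #{x ∈ S i | ¬ T.Fits (idx p) i (f p) x} := by
                gcongr
                exact (card_le_card h1).trans card_biUnion_le
            _ ≤ ∑ p with grp p ∈ D, #(S i) := by
                rw [mul_sum]
                exact sum_le_sum fun p hp => hS.fits _ (hidx p) i hi _
                  (hslot p (hf p (mem_filter.1 hp).2))
            _ ≤ m * #(S i) := by
                rw [sum_const, smul_eq_mul]
                gcongr
                exact (card_le_univ _).trans_eq (Fintype.card_fin m))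
      have hne : ∀ p, grp p ∈ D → grp p ≠ g := fun p hp e => hg (e ▸ hp)
      refine ⟨fun v => if grp v = g then f' v else f v, fun v hv => ?_, fun u v hu hv huv => ?_⟩
      · rcases mem_insert.1 hv with h | h
        · simpa [h] using (hf' v h).1
        · simpa [hne v h] using hf v h
      · rcases mem_insert.1 hu with hu | hu <;> rcases mem_insert.1 hv with hv | hv
        · simpa [hu, hv] using hff' u v hu hv huv
        · simp only [hu, if_true, hne v hv, if_false]
          obtain ⟨h1, h2⟩ := hf' u hu
          rcases hcross u v (by rw [hu]; exact (hne v hv).symm) huv with h | h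
          · exact ((mem_filter.1 h2).2 v hv).2 h
          · exact h.2 _ h1 _ (hf v hv)
        · simp only [hv, if_true, hne u hu, if_false]
          obtain ⟨h1, h2⟩ := hf' v hv
          rcases hcross u v (by rw [hv]; exact hne u hu) huv with h | h
          · exact ((mem_filter.1 h2).2 u hu).1 h
          · exact h.2 _ (hf u hu) _ h1
        · simpa [hne u hu, hne v hv] using hff u v hu hv huv
  obtain ⟨f, -, hf⟩ := key univ
  exact contains_of_forall_adj f fun u v => hf u v (mem_univ _) (mem_univ _)

lemma exists_forall_exists_rel {α β ι : Type*} (r : α → β → Prop) (I : Finset ι) (A : Finset α)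
    (W : ι → Finset β) (hA : A.Nonempty)
    (h : ∀ i ∈ I, ∀ A' ⊆ A, #A ≤ #I * #A' → ∃ a ∈ A', ∃ b ∈ W i, r a b) :
    ∃ a ∈ A, ∀ i ∈ I, ∃ b ∈ W i, r a b := by
  by_contra! hno
  obtain ⟨i, hi, hc⟩ := exists_card_le_mul_card_filter I A (fun i a => ∀ b ∈ W i, ¬ r a b) hA hno
  obtain ⟨a, ha, b, hb, hab⟩ := h i hi _ (filter_subset _ _) hc
  exact (mem_filter.1 ha).2 b hb hab

lemma exists_subset_forall_of_card_le {α : Type*} {N M : ℕ} {Z : Finset α} (P : α → Prop)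
    (hZ : N ≤ M * #Z) (h : ∀ Y ⊆ Z, N ≤ 2 * M * #Y → ∃ a ∈ Y, P a) :
    ∃ Y ⊆ Z, N ≤ 2 * M * #Y ∧ ∀ a ∈ Y, P a := by
  refine ⟨{a ∈ Z | P a}, filter_subset _ _, ?_, fun a ha => (mem_filter.1 ha).2⟩
  have hc := card_filter_add_card_filter_not (s := Z) P
  by_contra! hlt
  obtain ⟨a, ha, hPa⟩ := h {a ∈ Z | ¬ P a} (filter_subset _ _) (by
    rw [← hc] at hZ
    nlinarith)
  exact (mem_filter.1 ha).2 hPa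

lemma IsScheme.exists_star {T : Tournament n} {w : ℕ → Prop} {K L C : ℕ}
    {S : ℕ → Finset (Fin n)} (hS : T.IsScheme w K (16 * m * m) L C S)
    {i j : ℕ} (hi : i < K) (hj : j < K) (hij : i ≠ j) (hw : ¬ w i) {A : Finset (Fin n)}
    (hA : A ⊆ S i) (hAne : A.Nonempty) (hAc : #(S i) ≤ 8 * m * #A) {ι : Type*} (I : Finset ι)
    (hI : #I ≤ m) (W : ι → Finset (Fin n)) (hW : ∀ v ∈ I, W v ⊆ S j)
    (hWc : ∀ v ∈ I, #(S j) ≤ 8 * m * #(W v)) :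
    (∃ a ∈ A, ∀ v ∈ I, ∃ b ∈ W v, T.adj a b) ∧ ∃ a ∈ A, ∀ v ∈ I, ∃ b ∈ W v, T.adj b a := by
  have h1 : ∀ A' : Finset (Fin n), #A ≤ #I * #A' → #(S i) ≤ 16 * m * m * #A' := fun A' h =>
    calc #(S i) ≤ 8 * m * #A := hAc
      _ ≤ 8 * m * (m * #A') := by gcongr; exact h.trans (Nat.mul_le_mul_right _ hI)
      _ ≤ _ := by nlinarith [Nat.zero_le (m * m * #A')]
  have h2 : ∀ v ∈ I, #(S j) ≤ 16 * m * m * #(W v) := fun v hv => by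
    have hm : 1 ≤ m := (card_pos.2 ⟨v, hv⟩).trans_le hI
    calc #(S j) ≤ 8 * m * #(W v) := hWc v hv
      _ ≤ 16 * m * m * #(W v) := by gcongr; nlinarith
  constructor
  · refine exists_forall_exists_rel T.adj I A W hAne fun v hv A' hA' hc => ?_
    exact hS.exists_adj i hi j hj hij (Or.inl hw) A' (hA'.trans hA) (W v) (hW v hv) (h1 A' hc)
      (h2 v hv)
  · refine exists_forall_exists_rel (fun a b => T.adj b a) I A W hAne fun v hv A' hA' hc => ?_
    obtain ⟨b, hb, a, ha, hba⟩ := hS.exists_adj j hj i hi hij.symm (Or.inr hw) (W v) (hW v hv) A'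
      (hA'.trans hA) (h2 v hv) (h1 A' hc)
    exact ⟨a, ha, b, hb, hba⟩

lemma contains_K6 {T : Tournament n} {v₁ v₂ v₃ v₄ v₅ v₆ : Fin n} (h12 : T.adj v₁ v₂)
    (h13 : T.adj v₁ v₃) (h41 : T.adj v₄ v₁) (h15 : T.adj v₁ v₅) (h61 : T.adj v₆ v₁)
    (h23 : T.adj v₂ v₃) (h24 : T.adj v₂ v₄) (h52 : T.adj v₅ v₂) (h26 : T.adj v₂ v₆)
    (h34 : T.adj v₃ v₄) (h35 : T.adj v₃ v₅) (h63 : T.adj v₆ v₃) (h45 : T.adj v₄ v₅)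
    (h46 : T.adj v₄ v₆) (h56 : T.adj v₅ v₆) : T.Contains K6 := by
  refine contains_of_forall_adj ![v₁, v₂, v₃, v₄, v₅, v₆] fun u v h => ?_
  fin_cases u <;> fin_cases v <;> first | simpa | simp [K6, K6back] at h

lemma IsScheme.exists_triangle {T : Tournament n} (hT : ¬ T.Contains K6) {K C : ℕ}
    {S : ℕ → Finset (Fin n)}
    (hS : T.IsScheme (fun i => i % 3 = 0) K (16 * m * m) (8 * m * (m + 2)) C S) (hm : 0 < m)
    {α β γ : ℕ} (hαβ : α < β) (hβγ : β ≤ γ) (hγ : 3 * γ + 2 < K) {Z : ℕ → Finset (Fin n)}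
    (hZ : ∀ i < K, IsMost (8 * m * (m + 2)) m (S i) (Z i)) {B₁ B₂ : Finset (Fin n)}
    (hB₁ : B₁ ⊆ S (3 * β)) (hB₂ : B₂ ⊆ S (3 * β)) (hB₁c : #(S (3 * β)) ≤ 4 * m * #B₁)
    (hB₂c : #(S (3 * β)) ≤ 4 * m * #B₂) (hB : ∀ u ∈ B₁, ∀ v ∈ B₂, T.adj u v) :
    ∃ a ∈ Z (3 * α + 1), ∃ b ∈ (B₁ ∪ B₂) ∩ Z (3 * β), ∃ c ∈ Z (3 * γ + 2),
      T.adj b a ∧ T.adj c a ∧ T.adj c b := by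
  have hbig : ∀ N x : ℕ, N ≤ 8 * m * x → N ≤ 16 * m * m * x := fun N x h =>
    h.trans (by gcongr; nlinarith)
  have hbig' : ∀ N x : ℕ, N ≤ 2 * (8 * m) * x → N ≤ 16 * m * m * x := fun N x h =>
    h.trans <| calc
      2 * (8 * m) * x = 16 * m * 1 * x := by ring
      _ ≤ _ := by gcongr; exact hm
  obtain ⟨v₅, hv₅, v₂, hv₂, h52⟩ := hS.exists_adj (3 * γ + 1) (by omega) (3 * α + 2) (by omega)
    (by omega) (Or.inl (by omega)) (Z (3 * γ + 1)) (hZ _ (by omega)).1 (Z (3 * α + 2))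
    (hZ _ (by omega)).1 (hbig _ _ ((hZ _ (by omega)).card_le hm (by omega)))
    (hbig _ _ ((hZ _ (by omega)).card_le hm (by omega)))
  have hv₅S := (hZ (3 * γ + 1) (by omega)).1 hv₅
  have hv₂S := (hZ (3 * α + 2) (by omega)).1 hv₂
  set Y : ℕ → Finset (Fin n) := fun i =>
    {u ∈ {u ∈ Z i | T.Fits (3 * α + 2) i v₂ u} | T.Fits (3 * γ + 1) i v₅ u} with hYdef
  have hY : ∀ i < K, IsMost (8 * m * (m + 2)) (m + 2) (S i) (Y i) := fun i hi =>
    ((hZ i hi).filter_fits hS (by omega) hi hv₂S).filter_fits hS (by omega) hi hv₅S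
  have hYZ : ∀ i, Y i ⊆ Z i := fun i => (filter_subset _ _).trans (filter_subset _ _)
  have hY₂ : ∀ i, ∀ u ∈ Y i, T.Fits (3 * α + 2) i v₂ u := fun i u hu =>
    (mem_filter.1 (mem_filter.1 hu).1).2
  have hY₅ : ∀ i, ∀ u ∈ Y i, T.Fits (3 * γ + 1) i v₅ u := fun i u hu => (mem_filter.1 hu).2
  have hB₁Y := (hY (3 * β) (by omega)).card_le_mul_card_inter hm le_rfl hB₁ hB₁c
  have hB₂Y := (hY (3 * β) (by omega)).card_le_mul_card_inter hm le_rfl hB₂ hB₂c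
  obtain ⟨A', hA'Y, hA'c, hA'⟩ :=
    exists_subset_forall_of_card_le (fun a => ∃ b ∈ B₂ ∩ Y (3 * β), T.adj b a)
    ((hY (3 * α + 1) (by omega)).card_le hm le_rfl) fun A hA hc => by
      obtain ⟨b, hb, a, ha, h⟩ := hS.exists_adj (3 * β) (by omega) (3 * α + 1) (by omega)
        (by omega) (Or.inr (by omega)) (B₂ ∩ Y (3 * β)) (inter_subset_left.trans hB₂) A
        (hA.trans (hY _ (by omega)).1) (hbig _ _ hB₂Y) (hbig' _ _ hc)
      exact ⟨a, ha, b, hb, h⟩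
  obtain ⟨C', hC'Y, hC'c, hC'⟩ :=
    exists_subset_forall_of_card_le (fun c => ∃ b ∈ B₁ ∩ Y (3 * β), T.adj c b)
    ((hY (3 * γ + 2) (by omega)).card_le hm le_rfl) fun C hC hc => by
      exact hS.exists_adj (3 * γ + 2) (by omega) (3 * β) (by omega)
        (by omega) (Or.inl (by omega)) C (hC.trans (hY _ (by omega)).1) (B₁ ∩ Y (3 * β))
        (inter_subset_left.trans hB₁) (hbig' _ _ hc) (hbig _ _ hB₁Y)
  obtain ⟨c, hc, a, ha, hca⟩ := hS.exists_adj (3 * γ + 2) (by omega) (3 * α + 1) (by omega)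
    (by omega) (Or.inl (by omega)) C' (hC'Y.trans (hY _ (by omega)).1) A'
    (hA'Y.trans (hY _ (by omega)).1) (hbig' _ _ hC'c) (hbig' _ _ hA'c)
  have hcY := hC'Y hc
  have haY := hA'Y ha
  obtain ⟨v₃, hv₃, hc3⟩ := hC' c hc
  obtain ⟨v₄, hv₄, h4a⟩ := hA' a ha
  rw [mem_inter] at hv₃ hv₄
  have h34 := hB v₃ hv₃.1 v₄ hv₄.1
  have hne3 : v₃ ≠ a := by
    rintro rfl
    exact T.asymm _ _ h34 h4a
  have hne4 : v₄ ≠ c := by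
    rintro rfl
    exact T.asymm _ _ h34 hc3
  by_cases h3a : T.adj v₃ a
  · exact ⟨a, hYZ _ haY, v₃, mem_inter.2 ⟨mem_union_left _ hv₃.1, hYZ _ hv₃.2⟩, c, hYZ _ hcY,
      h3a, hca, hc3⟩
  by_cases hc4 : T.adj c v₄
  · exact ⟨a, hYZ _ haY, v₄, mem_inter.2 ⟨mem_union_right _ hv₄.1, hYZ _ hv₄.2⟩, c, hYZ _ hcY,
      h4a, hca, hc4⟩
  refine absurd (contains_K6 (v₁ := a) (v₂ := v₂) (v₃ := v₃) (v₄ := v₄) (v₅ := v₅) (v₆ := c)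
    ((hY₂ _ a haY).2 (by omega)) (T.adj_of_not_adj hne3 h3a) h4a ((hY₅ _ a haY).2 (by omega)) hca
    ((hY₂ _ v₃ hv₃.2).1 (by omega)) ((hY₂ _ v₄ hv₄.2).1 (by omega)) h52
    ((hY₂ _ c hcY).1 (by omega)) h34 ((hY₅ _ v₃ hv₃.2).2 (by omega)) hc3
    ((hY₅ _ v₄ hv₄.2).2 (by omega)) (T.adj_of_not_adj hne4.symm hc4)
    ((hY₅ _ c hcY).1 (by omega))) hT

/-- The index of the set that hosts `v` when the vertices of `F`, ordered by `π`, are hosted by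
sets of their own: `3 b` for vertices outside `F` preceded by `b` vertices of `F`, and `3 b + 1`
or `3 b + 2` for vertices of `F`, depending on `R`. -/
noncomputable def hostIndex (π : Fin m → ℕ) (F R : Finset (Fin m)) (v : Fin m) : ℕ :=
  3 * #{u ∈ F | π u < π v} + if v ∈ F then if v ∈ R then 2 else 1 else 0

section hostIndex

variable {π : Fin m → ℕ} {F R : Finset (Fin m)} {u v : Fin m}

lemma hostIndex_lt : hostIndex π F R v < 3 * m + 3 := by
  have h : #{u ∈ F | π u < π v} ≤ m := (card_le_univ _).trans_eq (Fintype.card_fin m)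
  rw [hostIndex]
  split_ifs <;> omega

lemma hostIndex_of_notMem (h : v ∉ F) : hostIndex π F R v = 3 * #{u ∈ F | π u < π v} := by
  simp [hostIndex, h]

lemma hostIndex_of_mem (h : v ∈ F) (hR : v ∉ R) :
    hostIndex π F R v = 3 * #{u ∈ F | π u < π v} + 1 := by
  simp [hostIndex, h, hR]

lemma hostIndex_of_mem_of_mem (h : v ∈ F) (hR : v ∈ R) :
    hostIndex π F R v = 3 * #{u ∈ F | π u < π v} + 2 := by
  simp [hostIndex, h, hR]

lemma hostIndex_mod_three : hostIndex π F R v % 3 = 0 ↔ v ∉ F := by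
  rw [hostIndex]
  split_ifs <;> simp_all

lemma card_before_le (h : π u ≤ π v) : #{x ∈ F | π x < π u} ≤ #{x ∈ F | π x < π v} :=
  card_le_card fun x hx => by
    rw [mem_filter] at hx ⊢
    exact ⟨hx.1, hx.2.trans_le h⟩

lemma card_before_lt (hu : u ∈ F) (h : π u < π v) :
    #{x ∈ F | π x < π u} < #{x ∈ F | π x < π v} := by
  refine card_lt_card ⟨fun x hx => ?_, fun hsub => ?_⟩
  · rw [mem_filter] at hx ⊢
    exact ⟨hx.1, hx.2.trans h⟩
  · exact absurd (mem_filter.1 (hsub (mem_filter.2 ⟨hu, h⟩))).2 (lt_irrefl _)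

lemma hostIndex_lt_or_eq (h : π u < π v) : hostIndex π F R u < hostIndex π F R v ∨
    hostIndex π F R u = hostIndex π F R v ∧ u ∉ F ∧ v ∉ F := by
  by_cases hu : u ∈ F
  · have := card_before_lt hu h
    left
    simp only [hostIndex]
    split_ifs <;> omega
  · have := card_before_le (F := F) h.le
    by_cases hv : v ∈ F
    · left
      simp only [hostIndex, hu, hv, if_true, if_false]
      split_ifs <;> omega
    · rw [hostIndex_of_notMem hu, hostIndex_of_notMem hv]
      rcases this.lt_or_eq with h | h
      · left; omega
      · exact Or.inr ⟨by rw [h], hu, hv⟩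

lemma hostIndex_eq (hu : u ∉ F) (hv : v ∉ F) (hπ : Function.Injective π)
    (h : ∀ x ∈ F, ¬ (π u < π x ∧ π x < π v) ∧ ¬ (π v < π x ∧ π x < π u)) :
    hostIndex π F R u = hostIndex π F R v := by
  rw [hostIndex_of_notMem hu, hostIndex_of_notMem hv]
  congr 2
  refine filter_congr fun x hx => ?_
  have h1 : π x ≠ π u := fun e => hu (hπ e ▸ hx)
  have h2 : π x ≠ π v := fun e => hv (hπ e ▸ hx)
  have := h x hx
  omega

end hostIndex

/-- The hypothesis on one part `G` of the vertex set of `H` that makes it embeddable in a scheme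
regardless of the other parts. -/
def Placeable (T : Tournament n) (H : Tournament m) (K L : ℕ) (S : ℕ → Finset (Fin n))
    (idx : Fin m → ℕ) (slot : Fin m → Finset (Fin n)) (G : Finset (Fin m)) : Prop :=
  ∀ Z : ℕ → Finset (Fin n), (∀ i < K, IsMost L m (S i) (Z i)) →
    ∃ f : Fin m → Fin n, (∀ v ∈ G, f v ∈ slot v ∧ f v ∈ Z (idx v)) ∧
      ∀ u ∈ G, ∀ v ∈ G, H.adj u v → T.adj (f u) (f v)

lemma placeable_triangle {T : Tournament n} {H : Tournament m} (hm : 0 < m)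
    (hT : ¬ T.Contains K6) {K C : ℕ} {S : ℕ → Finset (Fin n)}
    (hS : T.IsScheme (fun i => i % 3 = 0) K (16 * m * m) (8 * m * (m + 2)) C S)
    {idx : Fin m → ℕ} {slot : Fin m → Finset (Fin n)} {a b c : Fin m} {α β γ : ℕ} (hαβ : α < β)
    (hβγ : β ≤ γ) (hγ : 3 * γ + 2 < K) (ha : idx a = 3 * α + 1) (hb : idx b = 3 * β)
    (hc : idx c = 3 * γ + 2) (hab : H.adj b a) (hac : H.adj c a) (hbc : H.adj c b)
    (hsa : slot a = S (idx a)) (hsc : slot c = S (idx c)) {B₁ B₂ : Finset (Fin n)}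
    (hsb : slot b = B₁ ∪ B₂) (hB₁ : B₁ ⊆ S (3 * β)) (hB₂ : B₂ ⊆ S (3 * β))
    (hB₁c : #(S (3 * β)) ≤ 4 * m * #B₁) (hB₂c : #(S (3 * β)) ≤ 4 * m * #B₂)
    (hB : ∀ u ∈ B₁, ∀ v ∈ B₂, T.adj u v) :
    Placeable T H K (8 * m * (m + 2)) S idx slot {a, b, c} := by
  intro Z hZ
  obtain ⟨x, hx, y, hy, z, hz, hyx, hzx, hzy⟩ :=
    hS.exists_triangle hT hm hαβ hβγ hγ hZ hB₁ hB₂ hB₁c hB₂c hB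
  rw [mem_inter] at hy
  have hba : b ≠ a := by rintro rfl; exact H.irrefl _ hab
  have hca : c ≠ a := by rintro rfl; exact H.irrefl _ hac
  have hcb : c ≠ b := by rintro rfl; exact H.irrefl _ hbc
  refine ⟨fun v => if v = a then x else if v = b then y else z, fun v hv => ?_,
    fun u hu v hv huv => ?_⟩
  · simp only [mem_insert, mem_singleton] at hv
    beta_reduce
    rcases hv with rfl | rfl | rfl
    · rw [if_pos rfl, hsa, ha]
      exact ⟨(hZ _ (by omega)).1 hx, hx⟩
    · rw [if_neg hba, if_pos rfl, hsb, hb]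
      exact hy
    · rw [if_neg hca, if_neg hcb, hsc, hc]
      exact ⟨(hZ _ (by omega)).1 hz, hz⟩
  · simp only [mem_insert, mem_singleton] at hu hv
    rcases hu with rfl | rfl | rfl <;> rcases hv with rfl | rfl | rfl <;>
      first
        | exact absurd huv (H.irrefl _)
        | exact absurd huv (H.asymm _ _ ‹_›)
        | simpa [hba, hca, hcb]

lemma placeable_star {T : Tournament n} {H : Tournament m} (hm : 0 < m) {w : ℕ → Prop} {K C : ℕ}
    {S : ℕ → Finset (Fin n)} (hS : T.IsScheme w K (16 * m * m) (8 * m * (m + 2)) C S)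
    {idx : Fin m → ℕ} {slot : Fin m → Finset (Fin n)} {Q : Finset (Fin m)} {c : Fin m} {j : ℕ}
    (hi : idx c < K) (hj : j < K) (hw : ¬ w (idx c)) (hwj : w j) (hcS : (S (idx c)).Nonempty)
    (hsc : slot c = S (idx c)) (hQ : ∀ v ∈ Q.erase c, idx v = j) {W : Fin m → Finset (Fin n)}
    (hWs : ∀ v ∈ Q.erase c, W v ⊆ slot v) (hWS : ∀ v ∈ Q.erase c, W v ⊆ S j)
    (hWc : ∀ v ∈ Q.erase c, #(S j) ≤ 4 * m * #(W v))
    (hWW : ∀ u ∈ Q.erase c, ∀ v ∈ Q.erase c, H.adj u v → ∀ x ∈ W u, ∀ y ∈ W v, T.adj x y)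
    (hdir : (∀ v ∈ Q.erase c, H.adj c v) ∨ ∀ v ∈ Q.erase c, H.adj v c) :
    Placeable T H K (8 * m * (m + 2)) S idx slot Q := by
  intro Z hZ
  have hij : idx c ≠ j := fun e => hw (e ▸ hwj)
  have hZc := (hZ _ hi).card_le hm (by omega)
  have hZne : (Z (idx c)).Nonempty := by
    rw [nonempty_iff_ne_empty]
    intro h
    have := hcS.card_pos
    rw [h, card_empty] at hZc
    omega
  have hstar := hS.exists_star hi hj hij hw (hZ _ hi).1 hZne hZc (Q.erase c)
    ((card_le_univ _).trans_eq (Fintype.card_fin m)) (fun v => W v ∩ Z j)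
    (fun v hv => inter_subset_left.trans (hWS v hv))
    fun v hv => (hZ j hj).card_le_mul_card_inter hm (by omega) (hWS v hv) (hWc v hv)
  have hfin : ∀ a ∈ Z (idx c), ∀ g : Fin m → Fin n, (∀ v ∈ Q.erase c, g v ∈ W v ∩ Z j ∧
      (H.adj c v → T.adj a (g v)) ∧ (H.adj v c → T.adj (g v) a)) →
      ∃ f : Fin m → Fin n, (∀ v ∈ Q, f v ∈ slot v ∧ f v ∈ Z (idx v)) ∧
        ∀ u ∈ Q, ∀ v ∈ Q, H.adj u v → T.adj (f u) (f v) := by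
    intro a ha g hg
    refine ⟨fun v => if v = c then a else g v, fun v hv => ?_, fun u hu v hv huv => ?_⟩
    · by_cases hvc : v = c
      · subst hvc
        simpa [hsc] using ⟨(hZ _ hi).1 ha, ha⟩
      · have hv' := mem_erase.2 ⟨hvc, hv⟩
        have := mem_inter.1 (hg v hv').1
        simpa [hvc, hQ v hv'] using ⟨hWs v hv' this.1, this.2⟩
    · by_cases huc : u = c <;> by_cases hvc : v = c
      · exact absurd (huc ▸ hvc ▸ huv) (H.irrefl _)
      · subst huc
        simpa [hvc] using (hg v (mem_erase.2 ⟨hvc, hv⟩)).2.1 huv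
      · subst hvc
        simpa [huc] using (hg u (mem_erase.2 ⟨huc, hu⟩)).2.2 huv
      · have hu' := mem_erase.2 ⟨huc, hu⟩
        have hv' := mem_erase.2 ⟨hvc, hv⟩
        simpa [huc, hvc] using hWW u hu' v hv' huv _ (mem_inter.1 (hg u hu').1).1 _
          (mem_inter.1 (hg v hv').1).1
  have hchoose : ∀ (a : Fin n) (r : Fin n → Prop),
      (∀ v ∈ Q.erase c, ∃ b ∈ W v ∩ Z j, r b) →
      ∃ g : Fin m → Fin n, ∀ v ∈ Q.erase c, g v ∈ W v ∩ Z j ∧ r (g v) := fun a r h => by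
    have h' : ∀ v, ∃ b, v ∈ Q.erase c → b ∈ W v ∩ Z j ∧ r b := fun v => by
      by_cases hv : v ∈ Q.erase c
      · obtain ⟨b, hb, hr⟩ := h v hv
        exact ⟨b, fun _ => ⟨hb, hr⟩⟩
      · exact ⟨a, fun h => absurd h hv⟩
    choose g hg using h'
    exact ⟨g, hg⟩
  rcases hdir with hdir | hdir
  · obtain ⟨a, ha, h⟩ := hstar.1
    obtain ⟨g, hg⟩ := hchoose a (T.adj a) h
    exact hfin a ha g fun v hv => ⟨(hg v hv).1, fun _ => (hg v hv).2,
      fun h => absurd h (H.asymm _ _ (hdir v hv))⟩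
  · obtain ⟨a, ha, h⟩ := hstar.2
    obtain ⟨g, hg⟩ := hchoose a (fun b => T.adj b a) h
    exact hfin a ha g fun v hv => ⟨(hg v hv).1, fun h => absurd h (H.asymm _ _ (hdir v hv)),
      fun _ => (hg v hv).2⟩

lemma backward_or_pos_lt_of_adj {H : Tournament m} {θ : Equiv.Perm (Fin m)} {u v : Fin m}
    (h : H.adj u v) : H.Backward θ u v ∨ pos θ u < pos θ v := by
  rcases lt_trichotomy (pos θ u) (pos θ v) with h' | h' | h'
  · exact Or.inr h'
  · exact absurd ((θ.symm.injective h' : u = v) ▸ h) (H.irrefl _)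
  · exact Or.inl ⟨h, h'⟩

lemma IsFrontierStarAt.adj_center {H : Tournament m} {θ : Equiv.Perm (Fin m)}
    {Q : Finset (Fin m)} {c : Fin m} (h : H.IsFrontierStarAt θ Q c) :
    (∀ v ∈ Q.erase c, H.adj c v) ∨ ∀ v ∈ Q.erase c, H.adj v c :=
  h.elim (fun h => Or.inr fun v hv => (h.2.2.1 v hv).2) fun h => Or.inl fun v hv => (h.2.2.1 v hv).2

lemma IsFrontierStarAt.not_betweenSet {H : Tournament m} {θ : Equiv.Perm (Fin m)}
    {Q : Finset (Fin m)} {c : Fin m} (h : H.IsFrontierStarAt θ Q c) :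
    ¬ BetweenSet θ (Q.erase c) c := by
  rintro ⟨u, hu, v, hv, huc, hcv⟩
  rcases h with h | h
  · exact lt_asymm huc (h.2.2.1 u hu).1
  · exact lt_asymm hcv (h.2.2.1 v hv).1

lemma IsFrontierStarAt.pos_lt_of_adj {H : Tournament m} {θ : Equiv.Perm (Fin m)}
    {Q : Finset (Fin m)} {c u v : Fin m} (h : H.IsFrontierStarAt θ Q c) (hu : u ∈ Q.erase c)
    (hv : v ∈ Q.erase c) (huv : H.adj u v) : pos θ u < pos θ v := by
  rw [mem_erase] at hu hv
  refine (backward_or_pos_lt_of_adj huv).resolve_left fun hb => ?_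
  rcases h with h | h
  · exact hv.1 (h.2.2.2 u hu.2 v hv.2 hb)
  · exact hu.1 (h.2.2.2 u hu.2 v hv.2 hb)

lemma IsFrontierStarAt.center_mem {H : Tournament m} {θ : Equiv.Perm (Fin m)}
    {Q : Finset (Fin m)} {c : Fin m} (h : H.IsFrontierStarAt θ Q c) : c ∈ Q :=
  h.elim (fun h => h.1) fun h => h.1

lemma IsFrontierStarAt.nonempty_erase {H : Tournament m} {θ : Equiv.Perm (Fin m)}
    {Q : Finset (Fin m)} {c : Fin m} (h : H.IsFrontierStarAt θ Q c) : (Q.erase c).Nonempty :=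
  h.elim (fun h => h.2.1) fun h => h.2.1

/-- The map from vertices to the parts of a decomposition into triangles, stars and singletons. -/
lemma exists_parts {l k : ℕ} {Δ : Fin l → Finset (Fin m)} {Q : Fin k → Finset (Fin m)}
    (hΔ : ∀ i j, i ≠ j → Disjoint (Δ i) (Δ j)) (hΔQ : ∀ i j, Disjoint (Δ i) (Q j))
    (hQ : ∀ i j, i ≠ j → Disjoint (Q i) (Q j)) :
    ∃ grp : Fin m → Fin l ⊕ Fin k ⊕ Fin m,
      (∀ v i, v ∈ Δ i → grp v = Sum.inl i) ∧ (∀ v j, v ∈ Q j → grp v = Sum.inr (Sum.inl j)) ∧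
      ∀ v, v ∈ Sum.elim Δ (Sum.elim Q fun u => {u}) (grp v) := by
  have h : ∀ v, ∃ g : Fin l ⊕ Fin k ⊕ Fin m, (∀ i, v ∈ Δ i → g = Sum.inl i) ∧
      (∀ j, v ∈ Q j → g = Sum.inr (Sum.inl j)) ∧
      v ∈ Sum.elim Δ (Sum.elim Q fun u => {u}) g := by
    intro v
    by_cases h : ∃ i, v ∈ Δ i
    · obtain ⟨i, hi⟩ := h
      refine ⟨Sum.inl i, fun i' hi' => ?_, fun j hj => ?_, hi⟩
      · by_contra hne
        exact disjoint_left.1 (hΔ i i' fun e => hne (e ▸ rfl)) hi hi'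
      · exact absurd hj (disjoint_left.1 (hΔQ i j) hi)
    · push Not at h
      by_cases h' : ∃ j, v ∈ Q j
      · obtain ⟨j, hj⟩ := h'
        refine ⟨Sum.inr (Sum.inl j), fun i hi => absurd hi (h i), fun j' hj' => ?_, hj⟩
        by_contra hne
        exact disjoint_left.1 (hQ j j' fun e => hne (e ▸ rfl)) hj hj'
      · push Not at h'
        exact ⟨Sum.inr (Sum.inr v), fun i hi => absurd hi (h i), fun j hj => absurd hj (h' j),
          mem_singleton_self v⟩
  choose grp hg using h
  exact ⟨grp, fun v => (hg v).1, fun v => (hg v).2.1, fun v => (hg v).2.2⟩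

theorem contains_of_isScheme {T : Tournament n} {H : Tournament m} (hm : 0 < m)
    (hH : H.IsCentralTriangularGalaxy) (hT : ¬ T.Contains K6) {S : ℕ → Finset (Fin n)}
    (hS : T.IsScheme (fun i => i % 3 = 0) (3 * m + 3) (16 * m * m) (8 * m * (m + 2)) (2 * m) S) :
    T.Contains H := by
  obtain ⟨θ, l, k, A, B, C, Q, ctr, hΔ, hQ, hΔΔ, hΔQ, hQQ, hback, hctr, hforb⟩ := hH
  set π : Fin m → ℕ := fun v => (pos θ v : ℕ) with hπ
  have hπi : Function.Injective π := fun u v h => θ.symm.injective (Fin.ext h)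
  have hπm : ∀ v, π v < m := fun v => (pos θ v).2
  set R : Finset (Fin m) := univ.image C with hR
  set F : Finset (Fin m) := (univ.image ctr ∪ univ.image A) ∪ R with hF
  have hF' : ∀ x, x ∈ F ↔ (∃ j, ctr j = x) ∨ (∃ i, A i = x) ∨ ∃ i, C i = x := by
    intro x
    simp [hF, hR]
  have hR' : ∀ x, x ∈ R ↔ ∃ i, C i = x := by
    intro x
    simp [hR]
  have hAm : ∀ i, A i ∈ ({A i, B i, C i} : Finset (Fin m)) := fun i => by simp
  have hBm : ∀ i, B i ∈ ({A i, B i, C i} : Finset (Fin m)) := fun i => by simp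
  have hCm : ∀ i, C i ∈ ({A i, B i, C i} : Finset (Fin m)) := fun i => by simp
  obtain ⟨P, hP⟩ := hS.exists_pieces hm
  set idx : Fin m → ℕ := hostIndex π F R with hidx
  set slot : Fin m → Finset (Fin n) :=
    fun v => P (idx v) (2 * π v) ∪ P (idx v) (2 * π v + 1) with hslot
  have hidxK : ∀ v, idx v < 3 * m + 3 := fun v => hostIndex_lt
  have hmod : ∀ v, idx v % 3 = 0 ↔ v ∉ F := fun v => hostIndex_mod_three
  have hj0 : ∀ v, 2 * π v < 2 * m := fun v => by have := hπm v; omega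
  have hj1 : ∀ v, 2 * π v + 1 < 2 * m := fun v => by have := hπm v; omega
  have hslotS : ∀ v, slot v ⊆ S (idx v) := fun v => union_subset
    ((hP _ (hidxK v)).1 _ (hj0 v)).1 ((hP _ (hidxK v)).1 _ (hj1 v)).1
  have hslotF : ∀ v ∈ F, slot v = S (idx v) := fun v hv => by
    have h := (hP _ (hidxK v)).2.1 fun h => (hmod v).1 h hv
    rw [hslot]
    simp only [h, union_self]
  have hSne : ∀ i < 3 * m + 3, (S i).Nonempty := fun i hi => card_pos.1 (by
    have := hS.le_card i hi
    omega)
  have hPadj : ∀ u v, idx u = idx v → u ∉ F → π u < π v → ∀ x ∈ slot u, ∀ y ∈ slot v,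
      T.adj x y := by
    intro u v he hu huv x hx y hy
    have h := (hP _ (hidxK u)).2.2 ((hmod u).2 hu)
    have h1 := hj1 u
    have h2 := hj1 v
    simp only [hslot, mem_union, ← he] at hx hy
    rcases hx with hx | hx <;> rcases hy with hy | hy <;>
      exact h _ (by omega) _ (by omega) (by omega) x hx y hy
  obtain ⟨grp, hg1, hg2, hg3⟩ := exists_parts hΔΔ hΔQ hQQ
  have hpl : ∀ g, Placeable T H (3 * m + 3) (8 * m * (m + 2)) S idx slot
      (Sum.elim (fun i => ({A i, B i, C i} : Finset (Fin m))) (Sum.elim Q fun u => {u}) g) := by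
    rintro (i | j | u)
    · obtain ⟨hab, hbc, hba', hca', hcb'⟩ := hΔ i
      have hAF : A i ∈ F := (hF' _).2 (Or.inr (Or.inl ⟨i, rfl⟩))
      have hCF : C i ∈ F := (hF' _).2 (Or.inr (Or.inr ⟨i, rfl⟩))
      have hCR : C i ∈ R := (hR' _).2 ⟨i, rfl⟩
      have hAR : A i ∉ R := fun h => by
        obtain ⟨i', hi'⟩ := (hR' _).1 h
        by_cases e : i' = i
        · subst e
          rw [hi'] at hbc
          exact lt_asymm hab hbc
        · exact disjoint_left.1 (hΔΔ i' i e) (hCm i') (hi' ▸ hAm i)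
      have hBF : B i ∉ F := fun h => by
        rcases (hF' _).1 h with ⟨j, hj⟩ | ⟨i', hi'⟩ | ⟨i', hi'⟩
        · exact disjoint_left.1 (hΔQ i j) (hBm i) (hj ▸ (hQ j).center_mem)
        · by_cases e : i' = i
          · subst e
            exact hab.ne (by rw [hi'])
          · exact disjoint_left.1 (hΔΔ i' i e) (hAm i') (hi' ▸ hBm i)
        · by_cases e : i' = i
          · subst e
            exact hbc.ne (by rw [hi'])
          · exact disjoint_left.1 (hΔΔ i' i e) (hCm i') (hi' ▸ hBm i)
      have hb : idx (B i) = 3 * #{x ∈ F | π x < π (B i)} := hostIndex_of_notMem hBF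
      have hc : idx (C i) = 3 * #{x ∈ F | π x < π (C i)} + 2 := hostIndex_of_mem_of_mem hCF hCR
      have hPB := hP _ (hidxK (B i))
      refine placeable_triangle hm hT hS (card_before_lt (π := π) hAF hab)
        (card_before_le (π := π) hbc.le)
        (hc.ge.trans_lt (hidxK (C i))) (hostIndex_of_mem hAF hAR) hb hc hba' hca' hcb'
        (hslotF _ hAF) (hslotF _ hCF) (B₁ := P (idx (B i)) (2 * π (B i))) (B₂ := P (idx (B i)) (2 * π (B i) + 1))
        rfl ?_ ?_ ?_ ?_ (hPB.2.2 ((hmod _).2 hBF) _ (hj0 _) _ (hj1 _) (by omega)) <;> rw [← hb]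
      · exact (hPB.1 _ (hj0 _)).1
      · exact (hPB.1 _ (hj1 _)).1
      · exact (hPB.1 _ (hj0 _)).2
      · exact (hPB.1 _ (hj1 _)).2
    · have hst := hQ j
      have hcF : ctr j ∈ F := (hF' _).2 (Or.inl ⟨j, rfl⟩)
      have hleaf : ∀ v ∈ (Q j).erase (ctr j), v ∉ F := fun v hv h => by
        rw [mem_erase] at hv
        rcases (hF' _).1 h with ⟨j', hj'⟩ | ⟨i, hi⟩ | ⟨i, hi⟩
        · by_cases e : j' = j
          · exact hv.1 (by rw [← hj', e])
          · exact disjoint_left.1 (hQQ j' j e) (hQ j').center_mem (hj' ▸ hv.2)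
        · exact disjoint_left.1 (hΔQ i j) (hAm i) (hi ▸ hv.2)
        · exact disjoint_left.1 (hΔQ i j) (hCm i) (hi ▸ hv.2)
      have hnot : ∀ x ∈ F, ¬ BetweenSet θ ((Q j).erase (ctr j)) x := fun x hx => by
        rcases (hF' _).1 hx with ⟨j', rfl⟩ | ⟨i, rfl⟩ | ⟨i, rfl⟩
        · by_cases e : j' = j
          · exact e ▸ (hQ j').not_betweenSet
          · exact hctr j' j e
        · exact hforb i j _ (by simp)
        · exact hforb i j _ (by simp)
      have heq : ∀ u ∈ (Q j).erase (ctr j), ∀ v ∈ (Q j).erase (ctr j), idx u = idx v :=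
        fun u hu v hv => hostIndex_eq (hleaf u hu) (hleaf v hv) hπi fun x hx =>
          ⟨fun h => hnot x hx ⟨u, hu, v, hv, h⟩, fun h => hnot x hx ⟨v, hv, u, hu, h⟩⟩
      obtain ⟨v₀, hv₀⟩ := hst.nonempty_erase
      refine placeable_star (W := slot) hm hS (hidxK (ctr j)) (hidxK v₀)
        (fun h => (hmod _).1 h hcF) ((hmod _).2 (hleaf _ hv₀)) (hSne _ (hidxK _)) (hslotF _ hcF)
        (fun v hv => heq v hv v₀ hv₀) (fun v hv => Subset.rfl)
        (fun v hv => heq v hv v₀ hv₀ ▸ hslotS v) (fun v hv => ?_)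
        (fun u hu v hv huv => hPadj u v (heq u hu v hv) (hleaf u hu) (hst.pos_lt_of_adj hu hv huv))
        hst.adj_center
      rw [← heq v hv v₀ hv₀]
      exact ((hP _ (hidxK v)).1 _ (hj0 v)).2.trans (Nat.mul_le_mul_left _
        (card_le_card subset_union_left))
    · intro Z hZ
      have h := (hZ _ (hidxK u)).card_le_mul_card_inter hm (by omega) (hslotS u)
        (((hP _ (hidxK u)).1 _ (hj0 u)).2.trans (Nat.mul_le_mul_left _
          (card_le_card subset_union_left)))
      have hpos := (hSne _ (hidxK u)).card_pos
      obtain ⟨x, hx⟩ : (slot u ∩ Z (idx u)).Nonempty := by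
        rw [← card_pos]
        by_contra h0
        rw [Nat.eq_zero_of_not_pos h0] at h
        omega
      refine ⟨fun _ => x, fun v hv => ?_, fun v hv v' hv' hvv => ?_⟩
      · rw [mem_singleton.1 hv]
        exact mem_inter.1 hx
      · rw [mem_singleton.1 hv, mem_singleton.1 hv'] at hvv
        exact absurd hvv (H.irrefl _)
  refine hS.contains_of_groups grp idx slot hidxK hslotS (fun u v huv hadj => ?_)
    (fun g Z hZ => ?_) ⟨(hSne 0 (by omega)).choose⟩
  · have hlt : π u < π v := (backward_or_pos_lt_of_adj hadj).resolve_left fun hb => by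
      rcases hback u v hb with ⟨i, hu, hv⟩ | ⟨j, hu, hv⟩
      · exact huv ((hg1 u i hu).trans (hg1 v i hv).symm)
      · exact huv ((hg2 u j hu).trans (hg2 v j hv).symm)
    exact (hostIndex_lt_or_eq hlt).imp_right fun h => ⟨h.1, hPadj u v h.1 h.2.1 hlt⟩
  · obtain ⟨f, hf, hff⟩ := hpl g Z hZ
    exact ⟨f, fun v hv => hf v (hv ▸ hg3 v), fun u v hu hv => hff u (hu ▸ hg3 u) v (hv ▸ hg3 v)⟩

theorem exists_isTransOn_rpow_le_card {H : Tournament m} (hH : H.IsCentralTriangularGalaxy) :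
    ∃ ε : ℝ, 0 < ε ∧ ∀ {n : ℕ} (T : Tournament n), ¬ T.Contains K6 → ¬ T.Contains H →
      ∀ X : Finset (Fin n), ∃ t ⊆ X, T.IsTransOn t ∧ (#X : ℝ) ^ ε ≤ #t := by
  rcases Nat.eq_zero_or_pos m with rfl | hm
  · exact ⟨1, one_pos, fun T _ hTH => absurd
      (contains_of_forall_adj (fun i => i.elim0) fun u => u.elim0) hTH⟩
  obtain ⟨ε, hε, h⟩ := exists_isScheme H (fun i => i % 3 = 0) (3 * m + 3) (16 * m * m)
    (8 * m * (m + 2)) (2 * m)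
  refine ⟨ε, hε, fun T hT hTH X => ?_⟩
  induction X using Finset.strongInduction with
  | H X ih =>
    by_contra! hX
    obtain ⟨S, hS⟩ := h T hTH X hX ih
    exact hTH (contains_of_isScheme hm hH hT hS)

lemma IsTransOn.card_le_trSize {T : Tournament n} {t : Finset (Fin n)} (ht : T.IsTransOn t) :
    #t ≤ T.trSize := by
  refine le_csSup ⟨n, ?_⟩ ⟨t, subset_univ t, ht, rfl⟩
  rintro _ ⟨s, _, _, rfl⟩
  exact (card_le_univ s).trans_eq (Fintype.card_fin n)

end Tournament

open Tournament

theorem K6_centralTriangularGalaxy_EH {n₂ : ℕ} (H : Tournament n₂)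
    (hH : H.IsCentralTriangularGalaxy) : EHPair K6 H := by
  obtain ⟨ε, hε, h⟩ := exists_isTransOn_rpow_le_card hH
  refine ⟨ε, hε, fun n T hT hTH => ?_⟩
  obtain ⟨t, -, ht, hle⟩ := h T hT hTH univ
  rw [card_univ, Fintype.card_fin] at hle
  exact hle.trans (Nat.cast_le.2 ht.card_le_trSize)
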